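/- arXiv:2306.05155 — 2 statements merged into one kernel-verified Lean document; each statement's English description precedes it below -/
import Mathlib

section
/- Let T be a tree of order n with diameter at least 4, and let T₁ be obtained from T by a proper generalized tree shift. Then the distance signless Laplacian spectral radius of the complement of T₁ is strictly greater than that of the complement of T: μ₁(T̄₁) > μ₁(T̄). -/
open SimpleGraph Matrix BigOperators Finset

noncomputable section

/-- Distance matrix of a graph on `Fin n`, with real entries. -/
def distM {n : ℕ} (G : SimpleGraph (Fin n)) : Matrix (Fin n) (Fin n) ℝ :=
  fun i j => (G.dist i j : ℝ)

/-- Transmission of a vertex: sum of distances to all vertices. -/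
def transm {n : ℕ} (G : SimpleGraph (Fin n)) (i : Fin n) : ℝ :=
  ∑ j, (G.dist i j : ℝ)

/-- Diagonal matrix of transmissions. -/
def trM {n : ℕ} (G : SimpleGraph (Fin n)) : Matrix (Fin n) (Fin n) ℝ :=
  Matrix.diagonal (transm G)

/-- Distance signless Laplacian. -/
def DQ {n : ℕ} (G : SimpleGraph (Fin n)) : Matrix (Fin n) (Fin n) ℝ :=
  trM G + distM G

/-- The `D_α` matrix. -/
def Dalpha {n : ℕ} (G : SimpleGraph (Fin n)) (α : ℝ) : Matrix (Fin n) (Fin n) ℝ :=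
  α • trM G + (1 - α) • distM G

/-- Largest eigenvalue of a real matrix. -/
def lam1 {n : ℕ} (M : Matrix (Fin n) (Fin n) ℝ) : ℝ :=
  sSup {t : ℝ | ∃ v : Fin n → ℝ, v ≠ 0 ∧ M.mulVec v = t • v}

/-- Degree of a vertex. -/
def deg {n : ℕ} (G : SimpleGraph (Fin n)) (x : Fin n) : ℕ :=
  (G.neighborSet x).ncard

/-- Number of pendant (degree-one) vertices. -/
def pendants {n : ℕ} (G : SimpleGraph (Fin n)) : ℕ :=
  {x : Fin n | deg G x = 1}.ncard

/-- Diameter: supremum of pairwise distances. -/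
def gdiam {n : ℕ} (G : SimpleGraph (Fin n)) : ℕ :=
  sSup {d : ℕ | ∃ x y : Fin n, G.dist x y = d}

/-- The graph obtained by moving all edges at `v` except `vw` to `u`. -/
def shift {n : ℕ} (T : SimpleGraph (Fin n)) (u v w : Fin n) : SimpleGraph (Fin n) :=
  SimpleGraph.fromRel (fun a b =>
    (T.Adj a b ∧ ((a ≠ v ∧ b ≠ v) ∨ (a = v ∧ b = w) ∨ (b = v ∧ a = w))) ∨
    (a = u ∧ T.Adj v b ∧ b ≠ w))

/-- `T₁` is obtained from `T` by a proper generalized tree shift. -/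
def IsProperGTS {n : ℕ} (T T₁ : SimpleGraph (Fin n)) : Prop :=
  ∃ (u v w : Fin n) (p : T.Walk u v), u ≠ v ∧ p.IsPath ∧
    T.Adj w v ∧ w ∈ p.support ∧
    (∀ x ∈ p.support, x ≠ u → x ≠ v → deg T x = 2) ∧
    deg T u ≠ 1 ∧ deg T v ≠ 1 ∧ T₁ = shift T u v w

/-- The Kelmans transformation at vertices `u`, `v`. -/
def kelmans {n : ℕ} (T : SimpleGraph (Fin n)) (u v : Fin n) : SimpleGraph (Fin n) :=
  SimpleGraph.fromRel (fun a b =>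
    (T.Adj a b ∧ ¬(a = v ∧ ¬T.Adj u b ∧ b ≠ u) ∧ ¬(b = v ∧ ¬T.Adj u a ∧ a ≠ u)) ∨
    (a = u ∧ T.Adj v b ∧ ¬T.Adj u b ∧ b ≠ u))

/-- Collapse the edge `ab` (identifying into `a`) and reuse `b` as a new pendant at `a`. -/
def collapseAddPendant {n : ℕ} (T : SimpleGraph (Fin n)) (a b : Fin n) : SimpleGraph (Fin n) :=
  SimpleGraph.fromRel (fun x y =>
    (x ≠ a ∧ x ≠ b ∧ y ≠ a ∧ y ≠ b ∧ T.Adj x y) ∨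
    (x = a ∧ y ≠ a ∧ y ≠ b ∧ (T.Adj a y ∨ T.Adj b y)) ∨
    (x = a ∧ y = b))

/-- The star `K_{1,n-1}` with centre `0`. -/
def starG (n : ℕ) [NeZero n] : SimpleGraph (Fin n) :=
  SimpleGraph.fromRel (fun a b => a = 0 ∨ b = 0)

/-- Irreducibility of a nonnegative matrix. -/
def IrreducibleM {n : ℕ} (M : Matrix (Fin n) (Fin n) ℝ) : Prop :=
  ∀ i j : Fin n, i ≠ j → ∃ k : ℕ, 0 < (M ^ k) i j


/-- `T` is a star: some centre is adjacent to exactly the other vertices, and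
there are no other edges. -/
def IsStar {n : ℕ} (T : SimpleGraph (Fin n)) : Prop :=
  ∃ c : Fin n, ∀ a b : Fin n, T.Adj a b ↔ (a ≠ b ∧ (a = c ∨ b = c))

/-- The all-ones matrix. -/
def Jmat (n : ℕ) : Matrix (Fin n) (Fin n) ℝ := Matrix.of fun _ _ => 1

theorem aux_psd {n : ℕ} (M : Matrix (Fin n) (Fin n) ℝ) (hM : M.IsHermitian) :
    (lam1 M • (1 : Matrix (Fin n) (Fin n) ℝ) - M).PosSemidef ∧
    (0 < n → ∃ v : Fin n → ℝ, v ≠ 0 ∧ M.mulVec v = lam1 M • v) := by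
  have hfin : {t : ℝ | ∃ v : Fin n → ℝ, v ≠ 0 ∧ M.mulVec v = t • v}.Finite := by
    refine (Module.End.finite_hasEigenvalue (Matrix.toLin' M)).subset ?_
    rintro t ⟨v, hv, h⟩
    exact Module.End.hasEigenvalue_of_hasEigenvector
      (x := v) ⟨by rw [Module.End.mem_eigenspace_iff]; simpa using h, hv⟩
  have hH : (lam1 M • (1 : Matrix (Fin n) (Fin n) ℝ) - M).IsHermitian := by
    refine Matrix.IsHermitian.sub ?_ hM
    ext i j
    simp [Matrix.conjTranspose_apply, Matrix.one_apply, eq_comm]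
  refine ⟨?_, fun hn => ?_⟩
  · rw [hH.posSemidef_iff_eigenvalues_nonneg]
    intro i
    have h := hH.mulVec_eigenvectorBasis i
    have hne : (⇑(hH.eigenvectorBasis i) : Fin n → ℝ) ≠ 0 := by
      intro h0
      have := hH.eigenvectorBasis.orthonormal.ne_zero i
      apply this
      ext j
      exact congrFun h0 j
    have : lam1 M - hH.eigenvalues i ≤ lam1 M := by
      apply le_csSup hfin.bddAbove
      refine ⟨_, hne, ?_⟩
      rw [Matrix.sub_mulVec, Matrix.smul_mulVec, Matrix.one_mulVec] at h
      rw [sub_smul, ← h]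
      abel
    simpa using this
  · have : lam1 M ∈ {t : ℝ | ∃ v : Fin n → ℝ, v ≠ 0 ∧ M.mulVec v = t • v} := by
      apply Set.Nonempty.csSup_mem _ hfin
      have h := hM.mulVec_eigenvectorBasis ⟨0, hn⟩
      refine ⟨_, _, ?_, h⟩
      intro h0
      apply hM.eigenvectorBasis.orthonormal.ne_zero ⟨0, hn⟩
      ext j
      exact congrFun h0 j
    exact this

theorem aux_rayleigh {n : ℕ} (M : Matrix (Fin n) (Fin n) ℝ) (hM : M.IsHermitian)
    (x : Fin n → ℝ) : x ⬝ᵥ (M *ᵥ x) ≤ lam1 M * (x ⬝ᵥ x) := by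
  have := (aux_psd M hM).1.dotProduct_mulVec_nonneg x
  simp [Matrix.sub_mulVec, Matrix.smul_mulVec, dotProduct_sub] at this
  linarith

theorem aux_rayleigh_eq {n : ℕ} (M : Matrix (Fin n) (Fin n) ℝ) (hM : M.IsHermitian)
    (x : Fin n → ℝ) (h : lam1 M * (x ⬝ᵥ x) ≤ x ⬝ᵥ (M *ᵥ x)) : M *ᵥ x = lam1 M • x := by
  have h2 := aux_rayleigh M hM x
  have := ((aux_psd M hM).1.dotProduct_mulVec_zero_iff x).1
    (by simp [Matrix.sub_mulVec, Matrix.smul_mulVec, dotProduct_sub]; linarith)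
  simp [Matrix.sub_mulVec, Matrix.smul_mulVec] at this
  exact (sub_eq_zero.1 this).symm

theorem aux_perron {n : ℕ} (hn : 0 < n) (M : Matrix (Fin n) (Fin n) ℝ) (hM : M.IsHermitian)
    (h0 : ∀ i j, 0 ≤ M i j) (hpos : ∀ i j, i ≠ j → 0 < M i j) :
    ∃ x : Fin n → ℝ, (∀ i, 0 ≤ x i) ∧ (∀ i j, i ≠ j → 0 < x i + x j) ∧
      M *ᵥ x = lam1 M • x := by
  obtain ⟨v, hv, h⟩ := (aux_psd M hM).2 hn
  have hx : M *ᵥ (fun i => |v i|) = lam1 M • (fun i => |v i|) := by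
    apply aux_rayleigh_eq M hM
    have e1 : (fun i => |v i|) ⬝ᵥ (fun i => |v i|) = v ⬝ᵥ v := by
      simp [dotProduct]
    rw [e1]
    have e2 : lam1 M * (v ⬝ᵥ v) = v ⬝ᵥ (M *ᵥ v) := by rw [h]; simp
    rw [e2]
    simp only [dotProduct, Matrix.mulVec, Finset.mul_sum]
    refine Finset.sum_le_sum fun i _ => Finset.sum_le_sum fun j _ => ?_
    calc v i * (M i j * v j) ≤ |v i * (M i j * v j)| := le_abs_self _
      _ = |v i| * (M i j * |v j|) := by rw [abs_mul, abs_mul, abs_of_nonneg (h0 i j)]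
  have hp : ∀ i, 0 < |v i| := by
    intro i
    by_contra hi
    have hi : |v i| = 0 := le_antisymm (not_lt.1 hi) (abs_nonneg _)
    have := congrFun hx i
    simp only [Matrix.mulVec, dotProduct, Pi.smul_apply, hi, smul_zero] at this
    rw [Finset.sum_eq_zero_iff_of_nonneg (fun j _ => mul_nonneg (h0 i j) (abs_nonneg _))] at this
    apply hv
    ext j
    by_cases hij : i = j
    · subst hij; simpa using hi
    · have h3 := this j (Finset.mem_univ _)
      rcases mul_eq_zero.1 h3 with h4 | h4
      · exact absurd h4 (hpos i j hij).ne'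
      · simpa using h4
  exact ⟨fun i => |v i|, fun i => (hp i).le, fun i j _ => add_pos (hp i) (hp j), hx⟩

theorem DQ_herm {n : ℕ} (G : SimpleGraph (Fin n)) : (DQ G).IsHermitian := by
  ext i j
  simp only [DQ, trM, distM, Matrix.conjTranspose_apply, Matrix.add_apply, star_trivial,
    G.dist_comm (u := j)]
  by_cases h : i = j
  · subst h; rfl
  · rw [Matrix.diagonal_apply_ne _ h, Matrix.diagonal_apply_ne' _ h]

theorem DQ_row {n : ℕ} (G : SimpleGraph (Fin n)) (x : Fin n → ℝ) (i : Fin n) :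
    (DQ G *ᵥ x) i = ∑ j, (G.dist i j : ℝ) * (x i + x j) := by
  simp only [DQ, trM, Matrix.add_mulVec, Pi.add_apply, Matrix.mulVec_diagonal, transm]
  simp only [Matrix.mulVec, dotProduct, distM, mul_add, Finset.sum_add_distrib, Finset.sum_mul]

theorem DQ_quad {n : ℕ} (G : SimpleGraph (Fin n)) (x : Fin n → ℝ) :
    2 * (x ⬝ᵥ (DQ G *ᵥ x)) = ∑ i, ∑ j, (G.dist i j : ℝ) * (x i + x j) ^ 2 := by
  have e1 : x ⬝ᵥ (DQ G *ᵥ x) = ∑ i, ∑ j, (G.dist i j : ℝ) * (x i + x j) * x i := by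
    simp only [dotProduct, DQ_row, Finset.mul_sum]
    exact Finset.sum_congr rfl fun i _ => Finset.sum_congr rfl fun j _ => by ring
  have e2 : x ⬝ᵥ (DQ G *ᵥ x) = ∑ i, ∑ j, (G.dist i j : ℝ) * (x i + x j) * x j := by
    rw [e1, Finset.sum_comm]
    exact Finset.sum_congr rfl fun i _ => Finset.sum_congr rfl fun j _ => by
      rw [G.dist_comm]; ring
  rw [two_mul]
  nth_rw 1 [e1]
  rw [e2]
  simp only [← Finset.sum_add_distrib]
  exact Finset.sum_congr rfl fun i _ => Finset.sum_congr rfl fun j _ => by ring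

theorem lam1_perm {n : ℕ} (M N : Matrix (Fin n) (Fin n) ℝ) (σ : Equiv.Perm (Fin n))
    (h : ∀ i j, M (σ i) (σ j) = N i j) : lam1 M = lam1 N := by
  have key : ∀ (M N : Matrix (Fin n) (Fin n) ℝ) (σ : Equiv.Perm (Fin n))
      (_ : ∀ i j, M (σ i) (σ j) = N i j) (t : ℝ),
      (∃ v : Fin n → ℝ, v ≠ 0 ∧ M.mulVec v = t • v) →
      (∃ v : Fin n → ℝ, v ≠ 0 ∧ N.mulVec v = t • v) := by
    rintro M N σ h t ⟨v, hv, e⟩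
    refine ⟨v ∘ σ, ?_, ?_⟩
    · intro h0
      apply hv
      ext i
      simpa using congrFun h0 (σ.symm i)
    · ext i
      have := congrFun e (σ i)
      simp only [Matrix.mulVec, dotProduct, Pi.smul_apply, Function.comp] at this ⊢
      rw [← this, ← Equiv.sum_comp σ (fun x => M (σ i) x * v x)]
      exact Finset.sum_congr rfl fun j _ => by rw [h]
  unfold lam1
  congr 1
  ext t
  exact ⟨key M N σ h t, key N M σ.symm (fun i j => by rw [← h]; simp) t⟩

theorem dist_iso_le {n : ℕ} {G H : SimpleGraph (Fin n)} (f : G ≃g H) (i j : Fin n) :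
    H.dist (f i) (f j) = G.dist i j := by
  have key : ∀ {G H : SimpleGraph (Fin n)} (f : G ≃g H) (i j : Fin n), G.Reachable i j →
    H.dist (f i) (f j) ≤ G.dist i j := by
    intro G H f i j hr
    obtain ⟨p, hp⟩ := hr.exists_walk_length_eq_dist
    rw [← hp]
    simpa using SimpleGraph.dist_le (p.map f.toHom)
  by_cases hr : G.Reachable i j
  · refine le_antisymm (key f i j hr) ?_
    have := key f.symm (f i) (f j) (f.reachable_iff.2 hr)
    simpa using this
  · rw [SimpleGraph.dist_eq_zero_of_not_reachable hr,
      SimpleGraph.dist_eq_zero_of_not_reachable (fun h => hr (f.reachable_iff.1 h))]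

theorem lam1_iso {n : ℕ} {G H : SimpleGraph (Fin n)} (f : G ≃g H) :
    lam1 (DQ Gᶜ) = lam1 (DQ Hᶜ) := by
  let g : Gᶜ ≃g Hᶜ := ⟨f.toEquiv, by
    intro a b
    simp only [SimpleGraph.compl_adj]
    exact and_congr (not_congr f.toEquiv.apply_eq_iff_eq) (not_congr f.map_rel_iff)⟩
  symm
  apply lam1_perm _ _ f.toEquiv
  intro i j
  have hd : ∀ a b, Hᶜ.dist (f.toEquiv a) (f.toEquiv b) = Gᶜ.dist a b := fun a b => dist_iso_le g a b
  simp only [DQ, trM, distM, Matrix.add_apply, hd]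
  congr 1
  by_cases h : i = j
  · subst h
    simp only [Matrix.diagonal_apply_eq, transm]
    rw [← Equiv.sum_comp f.toEquiv]
    simp only [hd]
  · rw [Matrix.diagonal_apply_ne _ h, Matrix.diagonal_apply_ne]
    simpa using h

theorem common_non {n : ℕ} (T : SimpleGraph (Fin n)) (hT : T.Connected) (hd : 4 ≤ gdiam T)
    (a b : Fin n) (hab : T.Adj a b) : ∃ y, y ≠ a ∧ y ≠ b ∧ ¬ T.Adj a y ∧ ¬ T.Adj b y := by
  by_contra hcon
  push Not at hcon
  have hfin : {d : ℕ | ∃ x y : Fin n, T.dist x y = d}.Finite := by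
    refine (Set.finite_range (fun q : Fin n × Fin n => T.dist q.1 q.2)).subset ?_
    rintro d ⟨x, y, h⟩
    exact ⟨(x, y), h⟩
  obtain ⟨x, y, hxy⟩ : gdiam T ∈ {d : ℕ | ∃ x y : Fin n, T.dist x y = d} :=
    Set.Nonempty.csSup_mem ⟨_, a, a, rfl⟩ hfin
  have key : ∀ y, T.dist y a ≤ 1 ∨ T.dist y b ≤ 1 := by
    intro y
    by_cases h1 : y = a
    · left; simp [h1]
    by_cases h2 : y = b
    · right; simp [h2]
    by_cases h3 : T.Adj a y
    · left; exact (SimpleGraph.dist_eq_one_iff_adj.2 h3.symm).le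
    · right; exact (SimpleGraph.dist_eq_one_iff_adj.2 (hcon y h1 h2 h3).symm).le
  have hab1 := SimpleGraph.dist_eq_one_iff_adj.2 hab
  have hab2 := SimpleGraph.dist_eq_one_iff_adj.2 hab.symm
  have t1 := hT.dist_triangle (u := x) (v := a) (w := y)
  have t2 := hT.dist_triangle (u := x) (v := b) (w := y)
  have t3 := hT.dist_triangle (u := a) (v := b) (w := y)
  have t4 := hT.dist_triangle (u := b) (v := a) (w := y)
  have c1 := T.dist_comm (u := a) (v := y)
  have c2 := T.dist_comm (u := b) (v := y)
  rcases key x with h1 | h1 <;> rcases key y with h2 | h2 <;> omega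

theorem compl_dist_lower {n : ℕ} (T : SimpleGraph (Fin n)) (hc : Tᶜ.Connected) (a b : Fin n) :
    (a ≠ b → 1 ≤ Tᶜ.dist a b) ∧ (T.Adj a b → 2 ≤ Tᶜ.dist a b) := by
  refine ⟨fun h => hc.pos_dist_of_ne h, fun h => ?_⟩
  exact hc.one_lt_dist_of_ne_of_not_adj h.ne (by simp [SimpleGraph.compl_adj, h])

theorem compl_dist_T {n : ℕ} (T : SimpleGraph (Fin n)) (hT : T.Connected) (hd : 4 ≤ gdiam T) :
    Tᶜ.Connected ∧ ∀ a b, (¬ T.Adj a b → Tᶜ.dist a b ≤ 1) ∧ Tᶜ.dist a b ≤ 2 := by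
  have key : ∀ a b, Tᶜ.Reachable a b ∧ (¬ T.Adj a b → Tᶜ.dist a b ≤ 1) ∧ Tᶜ.dist a b ≤ 2 := by
    intro a b
    by_cases h0 : a = b
    · subst h0; simp
    by_cases h : T.Adj a b
    · obtain ⟨y, h1, h2, h3, h4⟩ := common_non T hT hd a b h
      have e1 : Tᶜ.Adj a y := by simp [SimpleGraph.compl_adj, h3, h1.symm]
      have e2 : Tᶜ.Adj y b := by
        simp only [SimpleGraph.compl_adj]; exact ⟨h2, fun h => h4 h.symm⟩
      refine ⟨e1.reachable.trans e2.reachable, fun h' => absurd h h', ?_⟩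
      simpa using SimpleGraph.dist_le (SimpleGraph.Walk.cons e1 (SimpleGraph.Walk.cons e2 .nil))
    · have e : Tᶜ.Adj a b := by simp [SimpleGraph.compl_adj, h, h0]
      have := SimpleGraph.dist_eq_one_iff_adj.2 e
      exact ⟨e.reachable, fun _ => this.le, by omega⟩
  have := hT.nonempty
  exact ⟨⟨fun a b => (key a b).1⟩, fun a b => (key a b).2⟩

theorem shift_adj {n : ℕ} (T : SimpleGraph (Fin n)) (u v w : Fin n) (huv : u ≠ v)
    (hw : T.Adj w v) (hu : T.Adj u v → w = u) (a b : Fin n) :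
    (shift T u v w).Adj a b ↔
      (T.Adj a b ∧ ¬ (a = v ∧ b ≠ w) ∧ ¬ (b = v ∧ a ≠ w)) ∨
      (a = u ∧ T.Adj v b ∧ b ≠ w) ∨ (b = u ∧ T.Adj v a ∧ a ≠ w) := by
  simp only [shift, SimpleGraph.fromRel_adj]
  have s1 := T.adj_comm a b
  have s2 := T.adj_comm u v
  have s3 := T.adj_comm w v
  have s4 := T.ne_of_adj (a := a) (b := b)
  have := hw.ne
  grind

theorem main_case {n : ℕ} (T : SimpleGraph (Fin n)) (u v w : Fin n) (hT : T.Connected)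
    (hd : 4 ≤ gdiam T) (huv : u ≠ v) (hw : T.Adj w v) (hu : T.Adj u v → w = u)
    (hz : ∀ z, T.Adj v z → z ≠ w → ¬ T.Adj u z) (hv : deg T v ≠ 1)
    (x : Fin n → ℝ) (hx0 : ∀ i, 0 ≤ x i) (hxp : ∀ i j, i ≠ j → 0 < x i + x j)
    (hx : DQ Tᶜ *ᵥ x = lam1 (DQ Tᶜ) • x) (hxuv : x v ≤ x u) :
    lam1 (DQ (shift T u v w)ᶜ) > lam1 (DQ Tᶜ) := by
  classical
  have hadj := shift_adj T u v w huv hw hu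
  set T₁ := shift T u v w with hT₁
  obtain ⟨hTc, hTd⟩ := compl_dist_T T hT hd
  -- connectedness of the new complement
  have huvr : T₁ᶜ.Reachable u v := by
    by_cases h : T.Adj u v
    · have hwu := hu h
      obtain ⟨y, h1, h2, h3, h4⟩ := common_non T hT hd u v h
      have e1 : T₁ᶜ.Adj u y := by
        rw [SimpleGraph.compl_adj, hadj]
        refine ⟨h1.symm, ?_⟩
        grind
      have e2 : T₁ᶜ.Adj v y := by
        rw [SimpleGraph.compl_adj, hadj]
        refine ⟨h2.symm, ?_⟩
        grind
      exact e1.reachable.trans e2.symm.reachable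
    · apply SimpleGraph.Adj.reachable
      rw [SimpleGraph.compl_adj, hadj]
      refine ⟨huv, ?_⟩
      have := T.loopless
      have := T.irrefl (v := v)
      grind
  have hvz : ∀ z, T.Adj v z → z ≠ w → T₁ᶜ.Adj v z := by
    intro z h1 h2
    rw [SimpleGraph.compl_adj, hadj]
    refine ⟨h1.ne, ?_⟩
    have := T.irrefl (v := v)
    grind
  have hstep : ∀ a b, Tᶜ.Adj a b → T₁ᶜ.Reachable a b := by
    intro a b hab
    rw [SimpleGraph.compl_adj] at hab
    by_cases h : T₁.Adj a b
    · rw [hadj] at h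
      rcases h with h | ⟨h1, h2, h3⟩ | ⟨h1, h2, h3⟩
      · exact absurd h.1 hab.2
      · subst h1
        exact huvr.trans (hvz b h2 h3).reachable
      · subst h1
        exact (huvr.trans (hvz a h2 h3).reachable).symm
    · apply SimpleGraph.Adj.reachable
      rw [SimpleGraph.compl_adj]
      exact ⟨hab.1, h⟩
  have hconn : T₁ᶜ.Connected := by
    have := hT.nonempty
    refine ⟨fun a b => ?_⟩
    obtain ⟨p⟩ := hTc a b
    induction p with
    | nil => exact SimpleGraph.Reachable.refl _
    | cons h p ih => exact (hstep _ _ h).trans ih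
  -- distance comparison
  let z : Fin n → ℝ := fun j => if T.Adj v j ∧ j ≠ w then 1 else 0
  have zu : z u = 0 := by
    have := T.adj_comm u v
    simp only [z]; rw [if_neg]; grind
  have zv : z v = 0 := by simp [z]
  have hle : ∀ i j, (Tᶜ.dist i j : ℝ) + ((if i = u then z j else 0) + (if j = u then z i else 0)
      - (if i = v then z j else 0) - (if j = v then z i else 0)) ≤ (T₁ᶜ.dist i j : ℝ) := by
    intro i j
    obtain ⟨l1, l2⟩ := compl_dist_lower T₁ hconn i j
    obtain ⟨m1, m2⟩ := hTd i j
    have hij := hadj i j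
    by_cases h0 : i = j
    · subst h0
      simp only [SimpleGraph.dist_self]
      by_cases h1 : i = u
      · subst h1; simp [zu, huv]
      · by_cases h2 : i = v
        · subst h2; simp [zv]
        · simp [h1, h2]
    have l1 := l1 h0
    have b1 : (1 : ℝ) ≤ T₁ᶜ.dist i j := by exact_mod_cast l1
    have b2 : (Tᶜ.dist i j : ℝ) ≤ 2 := by exact_mod_cast m2
    have b3 : ¬ T.Adj i j → (Tᶜ.dist i j : ℝ) ≤ 1 := fun h => by exact_mod_cast m1 h
    have b4 : T₁.Adj i j → (2 : ℝ) ≤ T₁ᶜ.dist i j := fun h => by exact_mod_cast l2 h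
    have s1 := T.adj_comm i j
    have s2 := T.adj_comm u v
    have s3 := T.adj_comm w v
    have hzi := hz i
    have hzj := hz j
    have iv := T.irrefl (v := v)
    simp only [z]
    clear hTd hadj hstep hvz hz
    by_cases i1 : i = u <;> by_cases i2 : i = v <;> by_cases j1 : j = u <;> by_cases j2 : j = v <;>
      grind
  have hlen : 0 < n := lt_of_le_of_lt (Nat.zero_le _) u.2
  -- Rayleigh quotient comparison
  have hquad : x ⬝ᵥ (DQ Tᶜ *ᵥ x) ≤ x ⬝ᵥ (DQ T₁ᶜ *ᵥ x) := by
    have q1 := DQ_quad Tᶜ x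
    have q2 := DQ_quad T₁ᶜ x
    have q3 : ∑ i, ∑ j, ((Tᶜ.dist i j : ℝ) + ((if i = u then z j else 0) +
        (if j = u then z i else 0) - (if i = v then z j else 0) - (if j = v then z i else 0)))
        * (x i + x j) ^ 2 ≤ ∑ i, ∑ j, (T₁ᶜ.dist i j : ℝ) * (x i + x j) ^ 2 :=
      Finset.sum_le_sum fun i _ => Finset.sum_le_sum fun j _ =>
        mul_le_mul_of_nonneg_right (hle i j) (sq_nonneg _)
    have q4 : ∑ i, ∑ j, ((Tᶜ.dist i j : ℝ) + ((if i = u then z j else 0) +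
        (if j = u then z i else 0) - (if i = v then z j else 0) - (if j = v then z i else 0)))
        * (x i + x j) ^ 2 = ∑ i, ∑ j, (Tᶜ.dist i j : ℝ) * (x i + x j) ^ 2
          + 2 * ∑ j, z j * ((x u + x j) ^ 2 - (x v + x j) ^ 2) := by
      simp only [add_mul, sub_mul, ite_mul, zero_mul, Finset.sum_add_distrib,
        Finset.sum_sub_distrib, Finset.sum_ite_eq', Finset.mem_univ, if_true]
      rw [Finset.sum_comm (f := fun i j => if i = u then z j * (x i + x j) ^ 2 else 0),
        Finset.sum_comm (f := fun i j => if i = v then z j * (x i + x j) ^ 2 else 0)]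
      simp only [Finset.sum_ite_eq', Finset.mem_univ, if_true, mul_sub, Finset.sum_sub_distrib]
      have c1 : ∀ y, ∑ i, z i * (x i + x y) ^ 2 = ∑ i, z i * (x y + x i) ^ 2 := fun y =>
        Finset.sum_congr rfl fun i _ => by ring
      rw [c1, c1]
      ring
    have q5 : 0 ≤ ∑ j, z j * ((x u + x j) ^ 2 - (x v + x j) ^ 2) := by
      refine Finset.sum_nonneg fun j _ => mul_nonneg ?_ ?_
      · simp only [z]; split_ifs <;> norm_num
      · have := hx0 v
        have := hx0 j
        nlinarith
    linarith
  by_contra hlt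
  have hlt : lam1 (DQ T₁ᶜ) ≤ lam1 (DQ Tᶜ) := not_lt.1 hlt
  have hxx : 0 ≤ x ⬝ᵥ x := by
    simp only [dotProduct]
    exact Finset.sum_nonneg fun i _ => mul_self_nonneg _
  have e0 : x ⬝ᵥ (DQ Tᶜ *ᵥ x) = lam1 (DQ Tᶜ) * (x ⬝ᵥ x) := by rw [hx]; simp
  have e1 := mul_le_mul_of_nonneg_right hlt hxx
  have e2 := aux_rayleigh _ (DQ_herm T₁ᶜ) x
  have e3 := aux_rayleigh_eq _ (DQ_herm T₁ᶜ) x (by linarith)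
  have r1 := congrFun e3 u
  have r2 := congrFun hx u
  rw [DQ_row] at r1 r2
  simp only [Pi.smul_apply, smul_eq_mul] at r1 r2
  have r3 := mul_le_mul_of_nonneg_right hlt (hx0 u)
  obtain ⟨z0, hz0, hz0'⟩ : ∃ z0, T.Adj v z0 ∧ z0 ≠ w := by
    by_contra hcon
    push Not at hcon
    apply hv
    have : T.neighborSet v = {w} := by
      ext y
      simp only [SimpleGraph.mem_neighborSet, Set.mem_singleton_iff]
      exact ⟨hcon y, fun h => h ▸ hw.symm⟩
    rw [deg, this, Set.ncard_singleton]
  have hrow : ∀ j, (Tᶜ.dist u j : ℝ) + z j ≤ T₁ᶜ.dist u j := by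
    intro j
    have := hle u j
    simpa [zu, huv] using this
  have znn : ∀ j, 0 ≤ z j := fun j => by simp only [z]; split_ifs <;> norm_num
  have hlt2 : ∑ j, (Tᶜ.dist u j : ℝ) * (x u + x j) < ∑ j, (T₁ᶜ.dist u j : ℝ) * (x u + x j) := by
    refine Finset.sum_lt_sum (fun j _ => ?_) ⟨z0, Finset.mem_univ _, ?_⟩
    · exact mul_le_mul_of_nonneg_right (by linarith [hrow j, znn j]) (add_nonneg (hx0 _) (hx0 _))
    · have hz1 : z z0 = 1 := by simp [z, hz0, hz0']
      have hne : u ≠ z0 := by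
        rintro rfl
        rw [zu] at hz1
        norm_num at hz1
      exact mul_lt_mul_of_pos_right (by linarith [hrow z0]) (hxp _ _ hne)
  linarith

theorem path_end {n : ℕ} {T : SimpleGraph (Fin n)} (hT : T.IsAcyclic) {u v w : Fin n}
    (p : T.Walk u v) (hp : p.IsPath) (hw : T.Adj w v) (hws : w ∈ p.support) :
    w = p.getVert (p.length - 1) := by
  have := hT.eq_snd_of_adj_start (p := p.reverse) hp.reverse hw.symm (by simpa using hws)
  rw [this, SimpleGraph.Walk.snd, SimpleGraph.Walk.getVert_reverse]

theorem path_inj {n : ℕ} {T : SimpleGraph (Fin n)} {u v : Fin n}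
    (p : T.Walk u v) (hp : p.IsPath) (i j : ℕ) (hi : i ≤ p.length) (hj : j ≤ p.length)
    (h : p.getVert i = p.getVert j) : i = j :=
  hp.getVert_injOn (by simpa using hi) (by simpa using hj) h

theorem path_one {n : ℕ} {T : SimpleGraph (Fin n)} (hT : T.IsAcyclic) {u v : Fin n}
    (p : T.Walk u v) (hp : p.IsPath) (h : T.Adj u v) : p.length = 1 := by
  have h1 := hT.eq_snd_of_adj_start hp h (by simp)
  have hl : 1 ≤ p.length := by
    by_contra hl
    have := SimpleGraph.Walk.eq_of_length_eq_zero (p := p) (by omega)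
    exact h.ne this
  apply path_inj p hp _ _ le_rfl hl
  rw [SimpleGraph.Walk.getVert_length]
  exact h1

theorem path_hz {n : ℕ} {T : SimpleGraph (Fin n)} (hT : T.IsAcyclic) {u v w : Fin n}
    (p : T.Walk u v) (hp : p.IsPath) (huv : u ≠ v) (hw : T.Adj w v) (hws : w ∈ p.support) :
    ∀ z, T.Adj v z → z ≠ w → ¬ T.Adj u z := by
  intro z hvz hzw huz
  by_cases hs : z ∈ p.support
  · exact hzw ((path_end hT p hp hvz.symm hs).trans (path_end hT p hp hw hws).symm)
  · have hq : (SimpleGraph.Walk.cons huz.symm p).IsPath := by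
      rw [SimpleGraph.Walk.cons_isPath_iff]; exact ⟨hp, hs⟩
    have := path_one hT _ hq hvz.symm
    rw [SimpleGraph.Walk.length_cons] at this
    exact huv (SimpleGraph.Walk.eq_of_length_eq_zero (p := p) (by omega))

theorem path_hu {n : ℕ} {T : SimpleGraph (Fin n)} (hT : T.IsAcyclic) {u v w : Fin n}
    (p : T.Walk u v) (hp : p.IsPath) (hw : T.Adj w v) (hws : w ∈ p.support) :
    T.Adj u v → w = u := by
  intro h
  rw [path_end hT p hp hw hws, path_one hT p hp h]
  simp

theorem shift_struct {n : ℕ} {T : SimpleGraph (Fin n)} (hT : T.IsAcyclic) {u v w : Fin n}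
    (p : T.Walk u v) (hp : p.IsPath) (huv : u ≠ v) (hw : T.Adj w v) (hws : w ∈ p.support)
    (hdeg : ∀ x ∈ p.support, x ≠ u → x ≠ v → deg T x = 2) :
    (∀ i j, i ≤ p.length → j ≤ p.length →
      ((shift T u v w).Adj (p.getVert i) (p.getVert j) ↔ (j = i + 1 ∨ i = j + 1))) ∧
    (∀ i b, i ≤ p.length → b ∉ p.support →
      ((shift T u v w).Adj (p.getVert i) b ↔ i = 0 ∧ (T.Adj u b ∨ T.Adj v b))) ∧
    (∀ a b, a ∉ p.support → b ∉ p.support → ((shift T u v w).Adj a b ↔ T.Adj a b)) := by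
  have hadj := shift_adj T u v w huv hw (path_hu hT p hp hw hws)
  have hwe := path_end hT p hp hw hws
  have inj := path_inj p hp
  have hk : 1 ≤ p.length := by
    by_contra hl
    exact huv (SimpleGraph.Walk.eq_of_length_eq_zero (p := p) (by omega))
  have hf0 : p.getVert 0 = u := p.getVert_zero
  have hfk : p.getVert p.length = v := p.getVert_length
  have hmem : ∀ i, p.getVert i ∈ p.support := fun i => p.getVert_mem_support i
  have hsucc : ∀ i, i < p.length → T.Adj (p.getVert i) (p.getVert (i + 1)) :=
    fun i hi => p.adj_getVert_succ hi
  have hint : ∀ i b, 0 < i → i < p.length → T.Adj (p.getVert i) b →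
      b = p.getVert (i - 1) ∨ b = p.getVert (i + 1) := by
    intro i b h0 hi hb
    have hd2 : deg T (p.getVert i) = 2 := by
      apply hdeg _ (hmem i)
      · intro h
        have := inj i 0 hi.le (by omega) (h.trans hf0.symm)
        omega
      · intro h
        have := inj i p.length hi.le le_rfl (h.trans hfk.symm)
        omega
    have hsub : ({p.getVert (i - 1), p.getVert (i + 1)} : Set (Fin n)) ⊆
        T.neighborSet (p.getVert i) := by
      intro y hy
      rcases hy with rfl | rfl
      · have := hsucc (i - 1) (by omega)
        rw [Nat.sub_add_cancel h0] at this
        exact this.symm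
      · exact hsucc i hi
    have hne : p.getVert (i - 1) ≠ p.getVert (i + 1) := by
      intro h
      have := inj _ _ (by omega) (by omega) h
      omega
    have := Set.eq_of_subset_of_ncard_le hsub (by
      rw [Set.ncard_pair hne]; exact hd2.le) (Set.toFinite _)
    have hb' : b ∈ T.neighborSet (p.getVert i) := hb
    rw [← this] at hb'
    simpa using hb'
  have hend : T.Adj u v → p.length = 1 := path_one hT p hp
  have hpp : ∀ i j, i < j → j ≤ p.length → T.Adj (p.getVert i) (p.getVert j) → j = i + 1 := by
    intro i j hij hj h
    by_cases h0 : 0 < i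
    · rcases hint i _ h0 (by omega) h with h | h
      · have := inj _ _ hj (by omega) h; omega
      · exact inj _ _ hj (by omega) h
    · by_cases hjk : j < p.length
      · rcases hint j _ (by omega) hjk h.symm with h | h
        · have := inj _ _ (by omega) (by omega) h; omega
        · have := inj _ _ (by omega) (by omega) h; omega
      · have hi : i = 0 := by omega
        have hj' : j = p.length := by omega
        rw [hi, hj', hf0, hfk] at h
        have := hend h
        omega
  have hpp' : ∀ i j, i ≤ p.length → j ≤ p.length →
      (T.Adj (p.getVert i) (p.getVert j) ↔ (j = i + 1 ∨ i = j + 1)) := by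
    intro i j hi hj
    constructor
    · intro h
      rcases lt_trichotomy i j with h1 | h1 | h1
      · exact Or.inl (hpp i j h1 hj h)
      · subst h1; exact absurd h (T.irrefl)
      · exact Or.inr (hpp j i h1 hi h.symm)
    · rintro (h | h)
      · subst h; exact hsucc i (by omega)
      · subst h; exact (hsucc j (by omega)).symm
  have hw' : ∀ i, i ≤ p.length → (p.getVert i = w ↔ i = p.length - 1) := by
    intro i hi
    rw [hwe]
    exact ⟨inj _ _ hi (by omega), fun h => by rw [h]⟩
  have hv' : ∀ i, i ≤ p.length → (p.getVert i = v ↔ i = p.length) := by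
    intro i hi
    exact ⟨fun h => inj _ _ hi (by omega) (h.trans hfk.symm), fun h => by rw [h, hfk]⟩
  have hu' : ∀ i, i ≤ p.length → (p.getVert i = u ↔ i = 0) := by
    intro i hi
    exact ⟨fun h => inj _ _ hi (by omega) (h.trans hf0.symm), fun h => by rw [h, hf0]⟩
  have hvp : ∀ i, i ≤ p.length → (T.Adj v (p.getVert i) ↔ i + 1 = p.length) := by
    intro i hi
    have := hpp' p.length i le_rfl hi
    rw [hfk] at this
    rw [this]
    omega
  refine ⟨fun i j hi hj => ?_, fun i b hi hb => ?_, fun a b ha hb => ?_⟩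
  · rw [hadj, hpp' i j hi hj, hvp i hi, hvp j hj, Ne, Ne, hw' i hi, hw' j hj, hv' i hi, hv' j hj,
      hu' i hi, hu' j hj]
    omega
  · have b1 : b ≠ v := by rintro rfl; exact hb p.end_mem_support
    have b2 : b ≠ u := by rintro rfl; exact hb p.start_mem_support
    have b3 : b ≠ w := by rintro rfl; exact hb hws
    rw [hadj, hv' i hi, hu' i hi]
    by_cases h0 : i = 0
    · subst h0
      rw [hf0]
      have : (0 : ℕ) ≠ p.length := by omega
      simp [b1, b2, b3, this]
    · by_cases hik : i = p.length
      · subst hik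
        simp [b1, b2, b3, h0]
      · have : ¬ T.Adj (p.getVert i) b := by
          intro h
          rcases hint i b (by omega) (by omega) h with h | h
          · exact hb (h ▸ hmem _)
          · exact hb (h ▸ hmem _)
        simp [this, h0, b2]
  · have b1 : b ≠ v := by rintro rfl; exact hb p.end_mem_support
    have b2 : b ≠ u := by rintro rfl; exact hb p.start_mem_support
    have a1 : a ≠ v := by rintro rfl; exact ha p.end_mem_support
    have a2 : a ≠ u := by rintro rfl; exact ha p.start_mem_support
    rw [hadj]
    simp [a1, a2, b1, b2]

theorem exists_reversal {n : ℕ} {T : SimpleGraph (Fin n)} {u v : Fin n}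
    (p : T.Walk u v) (hp : p.IsPath) :
    ∃ σ : Equiv.Perm (Fin n), (∀ i, i ≤ p.length → σ (p.getVert i) = p.getVert (p.length - i)) ∧
      ∀ a, a ∉ p.support → σ a = a := by
  classical
  let s : Fin n → Fin n := fun a =>
    if h : ∃ i, i ≤ p.length ∧ p.getVert i = a then p.getVert (p.length - h.choose) else a
  have s1 : ∀ i, i ≤ p.length → s (p.getVert i) = p.getVert (p.length - i) := by
    intro i hi
    have h : ∃ j, j ≤ p.length ∧ p.getVert j = p.getVert i := ⟨i, hi, rfl⟩
    have e : h.choose = i := path_inj p hp _ _ h.choose_spec.1 hi h.choose_spec.2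
    simp only [s]
    rw [dif_pos h, e]
  have s2 : ∀ a, a ∉ p.support → s a = a := by
    intro a ha
    simp only [s]
    rw [dif_neg]
    rintro ⟨i, _, rfl⟩
    exact ha (p.getVert_mem_support i)
  have hinv : Function.Involutive s := by
    intro a
    by_cases ha : a ∈ p.support
    · obtain ⟨i, rfl, hi⟩ := SimpleGraph.Walk.mem_support_iff_exists_getVert.1 ha
      rw [s1 i hi, s1 _ (by omega)]
      congr 1
      omega
    · rw [s2 a ha, s2 a ha]
  exact ⟨hinv.toPerm, s1, s2⟩

theorem shift_iso {n : ℕ} {T : SimpleGraph (Fin n)} (hT : T.IsAcyclic) {u v w w' : Fin n}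
    (p : T.Walk u v) (hp : p.IsPath) (huv : u ≠ v) (hw : T.Adj w v) (hws : w ∈ p.support)
    (hw' : T.Adj w' u) (hws' : w' ∈ p.support)
    (hdeg : ∀ x ∈ p.support, x ≠ u → x ≠ v → deg T x = 2) :
    Nonempty (shift T u v w ≃g shift T v u w') := by
  obtain ⟨A1, A2, A3⟩ := shift_struct hT p hp huv hw hws hdeg
  obtain ⟨B1, B2, B3⟩ := shift_struct hT p.reverse hp.reverse huv.symm hw' (by simpa using hws')
    (fun x hx h1 h2 => hdeg x (by simpa using hx) h2 h1)
  simp only [SimpleGraph.Walk.getVert_reverse, SimpleGraph.Walk.length_reverse,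
    SimpleGraph.Walk.support_reverse, List.mem_reverse] at B1 B2 B3
  obtain ⟨σ, s1, s2⟩ := exists_reversal p hp
  refine ⟨⟨σ, ?_⟩⟩
  intro a b
  by_cases ha : a ∈ p.support
  · obtain ⟨i, rfl, hi⟩ := SimpleGraph.Walk.mem_support_iff_exists_getVert.1 ha
    by_cases hb : b ∈ p.support
    · obtain ⟨j, rfl, hj⟩ := SimpleGraph.Walk.mem_support_iff_exists_getVert.1 hb
      rw [s1 i hi, s1 j hj, A1 i j hi hj, B1 i j hi hj]
    · rw [s1 i hi, s2 b hb, A2 i b hi hb, B2 i b hi hb, or_comm]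
  · by_cases hb : b ∈ p.support
    · obtain ⟨j, rfl, hj⟩ := SimpleGraph.Walk.mem_support_iff_exists_getVert.1 hb
      rw [SimpleGraph.adj_comm, SimpleGraph.adj_comm _ a,
        s1 j hj, s2 a ha, A2 j a hj ha, B2 j a hj ha, or_comm]
    · rw [s2 a ha, s2 b hb, A3 a b ha hb, B3 a b ha hb]

theorem stmt_5 (n : ℕ) (T T₁ : SimpleGraph (Fin n)) (hT : T.IsTree)
    (hd : 4 ≤ gdiam T) (h : IsProperGTS T T₁) :
    lam1 (DQ T₁ᶜ) > lam1 (DQ Tᶜ) := by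
  obtain ⟨u, v, w, p, huv, hp, hw, hws, hdeg, hdu, hdv, rfl⟩ := h
  have hTc : T.Connected := hT.1
  have hTa : T.IsAcyclic := hT.2
  have hn : 0 < n := lt_of_le_of_lt (Nat.zero_le _) u.2
  have hcc := (compl_dist_T T hTc hd).1
  have h0 : ∀ i j, 0 ≤ DQ Tᶜ i j := by
    intro i j
    have : 0 ≤ trM Tᶜ i j := by
      simp only [trM, Matrix.diagonal_apply]
      split_ifs
      · exact Finset.sum_nonneg fun j _ => Nat.cast_nonneg _
      · exact le_rfl
    exact add_nonneg this (Nat.cast_nonneg _)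
  have hpos : ∀ i j, i ≠ j → 0 < DQ Tᶜ i j := by
    intro i j hij
    have h1 : (0 : ℝ) < Tᶜ.dist i j := by exact_mod_cast hcc.pos_dist_of_ne hij
    simpa [DQ, trM, distM, Matrix.diagonal_apply_ne _ hij] using hcc.pos_dist_of_ne hij
  obtain ⟨x, hx0, hxp, hx⟩ := aux_perron hn (DQ Tᶜ) (DQ_herm _) h0 hpos
  rcases le_total (x v) (x u) with hle | hle
  · exact main_case T u v w hTc hd huv hw (path_hu hTa p hp hw hws)
      (path_hz hTa p hp huv hw hws) hdv x hx0 hxp hx hle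
  · have hk : 0 < p.length := by
      by_contra hl
      exact huv (SimpleGraph.Walk.eq_of_length_eq_zero (p := p) (by omega))
    have hw' : T.Adj (p.getVert 1) u := by
      have := p.adj_getVert_succ hk
      rw [SimpleGraph.Walk.getVert_zero] at this
      exact this.symm
    have hws' : p.getVert 1 ∈ p.support := p.getVert_mem_support 1
    have hws'' : p.getVert 1 ∈ p.reverse.support := by simp
    obtain ⟨f⟩ := shift_iso hTa p hp huv hw hws hw' hws' hdeg
    rw [lam1_iso f]
    exact main_case T v u _ hTc hd huv.symm hw' (path_hu hTa p.reverse hp.reverse hw' hws'')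
      (path_hz hTa p.reverse hp.reverse huv.symm hw' hws'') hdu x hx0 hxp hx hle
end
end

section
/- Let T be a tree on n ≥ 4 vertices that is neither the star K_{1,n−1} nor the path P_n. Then the distance spectral radius of the complement of T is strictly greater than the distance spectral radius of the complement of P_n: λ₁(T̄) > λ₁(P̄_n). -/
open SimpleGraph Matrix BigOperators Finset

noncomputable section

/-- Spectral facts: `lam1` is an eigenvalue and bounds the quadratic form. -/
theorem lam1_spec {n : ℕ} (hn : 0 < n) (M : Matrix (Fin n) (Fin n) ℝ)
    (hM : ∀ i j, M i j = M j i) :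
    (∃ v : Fin n → ℝ, v ≠ 0 ∧ M.mulVec v = lam1 M • v) ∧
    ∀ y : Fin n → ℝ, ∑ i, y i * (M.mulVec y) i ≤ lam1 M * ∑ i, y i ^ 2 := by
  have hH : M.IsHermitian := by
    ext i j
    simp [hM i j]
  have hsym : (Matrix.toEuclideanLin M).IsSymmetric :=
    Matrix.isSymmetric_toEuclideanLin_iff.mpr hH
  have : Nonempty (Fin n) := ⟨⟨0, hn⟩⟩
  have : Nontrivial (EuclideanSpace ℝ (Fin n)) := inferInstance
  have hE := hsym.hasEigenvalue_iSup_of_finiteDimensional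
  set T := Matrix.toEuclideanLin M with hT
  set t : ℝ := (⨆ x : { x : EuclideanSpace ℝ (Fin n) // x ≠ 0 },
    RCLike.re (inner ℝ (T x) (x : EuclideanSpace ℝ (Fin n))) / ‖(x : EuclideanSpace ℝ (Fin n))‖ ^ 2 : ℝ) with ht
  have hbdd : BddAbove (Set.range fun x : { x : EuclideanSpace ℝ (Fin n) // x ≠ 0 } =>
    RCLike.re (inner ℝ (T x) (x : EuclideanSpace ℝ (Fin n))) / ‖(x : EuclideanSpace ℝ (Fin n))‖ ^ 2) := by
    obtain ⟨b, hb⟩ := (T.toContinuousLinearMap).bddAbove_rayleighQuotient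
    refine ⟨b, ?_⟩
    rintro _ ⟨x, rfl⟩
    exact (le_abs_self _).trans (hb ⟨(x : EuclideanSpace ℝ (Fin n)), rfl⟩)
  have hinner : ∀ y : Fin n → ℝ, inner ℝ (T (WithLp.toLp 2 y)) (WithLp.toLp 2 y)
      = ∑ i, y i * (M.mulVec y) i := by
    intro y
    simp [hT, PiLp.inner_apply]
  have hq : ∀ y : Fin n → ℝ, ∑ i, y i * (M.mulVec y) i ≤ t * ∑ i, y i ^ 2 := by
    intro y
    by_cases hy : y = 0
    · subst hy; simp
    have hy' : (WithLp.toLp 2 y : EuclideanSpace ℝ (Fin n)) ≠ 0 := by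
      intro h; apply hy; ext i; simpa using congrArg (fun z : EuclideanSpace ℝ (Fin n) => z i) h
    have h1 := le_ciSup hbdd ⟨WithLp.toLp 2 y, hy'⟩
    have hpos : 0 < ‖(WithLp.toLp 2 y : EuclideanSpace ℝ (Fin n))‖ ^ 2 := by positivity
    have h2 : ‖(WithLp.toLp 2 y : EuclideanSpace ℝ (Fin n))‖ ^ 2 = ∑ i, y i ^ 2 := by
      rw [EuclideanSpace.norm_sq_eq]; simp
    rw [← ht] at h1
    simp only [RCLike.re_to_real] at h1
    rw [div_le_iff₀ hpos, hinner, h2] at h1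
    exact h1
  obtain ⟨v, hv⟩ := hE.exists_hasEigenvector
  have hv1 : M.mulVec v.ofLp = t • v.ofLp := by
    have := hv.apply_eq_smul
    have h3 := congrArg (fun z : EuclideanSpace ℝ (Fin n) => z.ofLp) this
    simpa [hT] using h3
  have hv0 : v.ofLp ≠ 0 := by
    intro h; exact hv.2 (by ext i; simpa using congrFun h i)
  have hlam : lam1 M = t := by
    have : IsGreatest {t : ℝ | ∃ v : Fin n → ℝ, v ≠ 0 ∧ M.mulVec v = t • v} t := by
      refine ⟨⟨_, hv0, hv1⟩, ?_⟩
      rintro s ⟨w, hw, hs⟩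
      have h4 := hq w
      rw [hs] at h4
      have h5 : ∑ i, w i * (s • w) i = s * ∑ i, w i ^ 2 := by
        rw [Finset.mul_sum]; refine Finset.sum_congr rfl fun i _ => ?_
        simp; ring
      rw [h5] at h4
      have h6 : 0 < ∑ i, w i ^ 2 := by
        obtain ⟨i, hi⟩ := Function.ne_iff.mp hw
        exact Finset.sum_pos' (fun _ _ => sq_nonneg _) ⟨i, Finset.mem_univ _, by
          simp at hi; positivity⟩
      exact le_of_mul_le_mul_right h4 h6
    exact this.csSup_eq
  rw [hlam]
  exact ⟨⟨_, hv0, hv1⟩, hq⟩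

/-- `u` is a leaf of the subgraph induced on `S`, with neighbour `p`. -/
def Lf {V : Type} (G : SimpleGraph V) (S : Finset V) (u p : V) : Prop :=
  u ∈ S ∧ p ∈ S ∧ G.Adj u p ∧ ∀ q ∈ S, G.Adj u q → q = p

open Classical in
/-- Quadratic form of the adjacency matrix restricted to `S`. -/
def QS {V : Type} (G : SimpleGraph V) (S : Finset V) (w : V → ℝ) : ℝ :=
  ∑ a ∈ S, ∑ b ∈ S, if G.Adj a b then w a * w b else 0

/-- Optimal path sum of a sorted sequence. -/
def pq (m : ℕ) (z : ℕ → ℝ) : ℝ := ∑ a ∈ Finset.range (m - 1), z a * z (min (a + 2) (m - 1))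

theorem pq_succ (m : ℕ) (z : ℕ → ℝ) :
    pq (m + 2) z = z 0 * z (min 2 (m + 1)) + pq (m + 1) (fun k => z (k + 1)) := by
  unfold pq
  simp only [show m + 2 - 1 = m + 1 by omega, show m + 1 - 1 = m by omega]
  rw [Finset.sum_range_succ', add_comm]
  congr 1
  refine Finset.sum_congr rfl fun a _ => ?_
  congr 2
  omega

theorem QS_step {V : Type} [DecidableEq V] (G : SimpleGraph V) (S : Finset V) (w : V → ℝ) (u p : V)
    (h : Lf G S u p) : QS G S w = 2 * (w u * w p) + QS G (S.erase u) w := by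
  classical
  obtain ⟨hu, hp, hadj, huniq⟩ := h
  have hpe : p ∈ S.erase u := Finset.mem_erase.mpr ⟨hadj.ne', hp⟩
  unfold QS
  rw [← Finset.add_sum_erase S _ hu]
  have h1 : ∀ a, (∑ b ∈ S, if G.Adj a b then w a * w b else 0)
      = (if G.Adj a u then w a * w u else 0)
        + ∑ b ∈ S.erase u, if G.Adj a b then w a * w b else 0 := fun a =>
    (Finset.add_sum_erase S _ hu).symm
  simp only [h1]
  rw [Finset.sum_add_distrib]
  have h2 : (∑ b ∈ S.erase u, if G.Adj u b then w u * w b else 0) = w u * w p := by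
    rw [Finset.sum_eq_single p]
    · simp [hadj]
    · intro b hb hbp
      rw [if_neg]
      intro hub
      exact hbp (huniq b (Finset.mem_of_mem_erase hb) hub)
    · intro h; exact absurd hpe h
  have h3 : (∑ b ∈ S.erase u, if G.Adj b u then w b * w u else 0) = w u * w p := by
    rw [← h2]
    refine Finset.sum_congr rfl fun b _ => ?_
    simp [G.adj_comm b u, mul_comm]
  rw [h2, h3]
  simp
  ring

theorem leaf_exists {V : Type} [DecidableEq V] (G : SimpleGraph V) (hG : G.IsAcyclic)
    (S : Finset V) (hc : (G.induce (S : Set V)).Connected) (hS : 2 ≤ S.card) :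
    ∃ u v p q, u ≠ v ∧ Lf G S u p ∧ Lf G S v q := by
  classical
  have ht : (G.induce (S : Set V)).IsTree := ⟨hc, hG.induce _⟩
  have : Nontrivial (S : Set V) := by
    obtain ⟨a, ha, b, hb, hab⟩ := Finset.one_lt_card.mp hS
    exact ⟨⟨a, ha⟩, ⟨b, hb⟩, by simpa using hab⟩
  have : Fintype (S : Set V) := inferInstance
  obtain ⟨u, v, huv, hu, hv⟩ := ht.exists_ne_and_degree_eq_one
  rw [degree_eq_one_iff_existsUnique_adj] at hu hv
  obtain ⟨p, hp, hp'⟩ := hu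
  obtain ⟨q, hq, hq'⟩ := hv
  refine ⟨u, v, p, q, fun h => huv (Subtype.ext h), ⟨u.2, p.2, hp, ?_⟩, ⟨v.2, q.2, hq, ?_⟩⟩
  · intro r hr hur
    exact congrArg Subtype.val (hp' ⟨r, hr⟩ hur)
  · intro r hr hur
    exact congrArg Subtype.val (hq' ⟨r, hr⟩ hur)

theorem leaf_exists_ne {V : Type} [DecidableEq V] (G : SimpleGraph V) (hG : G.IsAcyclic)
    (S : Finset V) (hc : (G.induce (S : Set V)).Connected) (hS : 2 ≤ S.card) (x : V) :
    ∃ u p, u ≠ x ∧ Lf G S u p := by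
  obtain ⟨u, v, p, q, huv, hu, hv⟩ := leaf_exists G hG S hc hS
  by_cases h : u = x
  · exact ⟨v, q, fun h' => huv (h.trans h'.symm), hv⟩
  · exact ⟨u, p, h, hu⟩

theorem leaf_conn {V : Type} [DecidableEq V] (G : SimpleGraph V)
    (S : Finset V) (hc : (G.induce (S : Set V)).Connected) (u p : V) (h : Lf G S u p) :
    (G.induce ((S.erase u : Finset V) : Set V)).Connected := by
  classical
  obtain ⟨hu, hp, hadj, huniq⟩ := h
  have hd : (G.induce (S : Set V)).degree ⟨u, hu⟩ = 1 := by
    rw [degree_eq_one_iff_existsUnique_adj]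
    exact ⟨⟨p, hp⟩, hadj, fun q hq => Subtype.ext (huniq q q.2 hq)⟩
  have hc' := hc.induce_compl_singleton_of_degree_eq_one hd
  let e : ((G.induce (S : Set V)).induce ({⟨u, hu⟩}ᶜ : Set (S : Set V))) ≃g
      (G.induce ((S.erase u : Finset V) : Set V)) :=
    { toFun := fun x => ⟨x.1.1, by
        have h1 := x.2
        have h2 := x.1.2
        simp only [Set.mem_compl_iff, Set.mem_singleton_iff] at h1
        simp only [Finset.coe_erase, Set.mem_sdiff, Set.mem_singleton_iff]
        exact ⟨h2, fun h => h1 (Subtype.ext h)⟩⟩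
      invFun := fun x => ⟨⟨x.1, by
        have := x.2
        simp at this
        exact this.1⟩, by
        have := x.2
        simp at this
        simp only [Set.mem_compl_iff, Set.mem_singleton_iff]
        intro h
        exact this.2 (congrArg Subtype.val h)⟩
      left_inv := fun x => rfl
      right_inv := fun x => rfl
      map_rel_iff' := Iff.rfl }
  exact e.connected_iff.mp hc'

/-- extension of an ordering by a new first vertex. -/
def ext0 {V : Type} [DecidableEq V] (u : V) (f : V → ℕ) : V → ℕ :=
  fun v => if v = u then 0 else f v + 1

theorem ext0_self {V : Type} [DecidableEq V] (u : V) (f : V → ℕ) : ext0 u f u = 0 := by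
  simp [ext0]

theorem ext0_ne {V : Type} [DecidableEq V] (u : V) (f : V → ℕ) {v : V} (h : v ≠ u) :
    ext0 u f v = f v + 1 := by
  simp [ext0, h]

theorem ext0_inj {V : Type} [DecidableEq V] (S : Finset V) (u : V) (f : V → ℕ)
    (h : Set.InjOn f (S.erase u : Finset V)) : Set.InjOn (ext0 u f) (S : Set V) := by
  intro a ha b hb hab
  by_cases h1 : a = u <;> by_cases h2 : b = u
  · rw [h1, h2]
  · subst h1; rw [ext0_self, ext0_ne _ _ h2] at hab; omega
  · subst h2; rw [ext0_self, ext0_ne _ _ h1] at hab; omega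
  · rw [ext0_ne _ _ h1, ext0_ne _ _ h2] at hab
    exact h (by simpa using ⟨ha, h1⟩) (by simpa using ⟨hb, h2⟩) (by omega)

theorem ext0_le {V : Type} [DecidableEq V] (S : Finset V) (u : V) (f : V → ℕ) (m : ℕ)
    (h : ∀ s ∈ S.erase u, f s ≤ m) : ∀ s ∈ S, ext0 u f s ≤ m + 1 := by
  intro s hs
  by_cases h1 : s = u
  · subst h1; rw [ext0_self]; omega
  · rw [ext0_ne _ _ h1]
    have := h s (Finset.mem_erase.mpr ⟨h1, hs⟩)
    omega

theorem QS_ext0 {V : Type} [DecidableEq V] (G : SimpleGraph V) (S : Finset V) (z : ℕ → ℝ)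
    (f : V → ℕ) (u p : V) (h : Lf G S u p) :
    QS G S (fun v => z (ext0 u f v)) = 2 * (z 0 * z (f p + 1))
      + QS G (S.erase u) (fun v => (fun k => z (k + 1)) (f v)) := by
  rw [QS_step G S _ u p h, ext0_self, ext0_ne _ _ h.2.2.1.ne']
  congr 1
  unfold QS
  refine Finset.sum_congr rfl fun a ha => Finset.sum_congr rfl fun b hb => ?_
  simp only [ext0_ne _ _ (Finset.ne_of_mem_erase ha), ext0_ne _ _ (Finset.ne_of_mem_erase hb)]

theorem weak_order {V : Type} [DecidableEq V] (G : SimpleGraph V) (hG : G.IsAcyclic) :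
    ∀ (m : ℕ) (S : Finset V), S.card = m + 1 → (G.induce (S : Set V)).Connected →
    ∀ u ∈ S, (m = 0 ∨ ∃ p, Lf G S u p) → ∀ z : ℕ → ℝ, Monotone z → (∀ k, 0 ≤ z k) →
    ∃ f : V → ℕ, Set.InjOn f (S : Set V) ∧ (∀ s ∈ S, f s ≤ m) ∧ f u = 0 ∧
      2 * pq (m + 1) z ≤ QS G S (fun v => z (f v)) := by
  intro m
  induction m with
  | zero =>
    intro S hS _ u hu _ z _ _
    obtain ⟨x, rfl⟩ := Finset.card_eq_one.mp hS
    refine ⟨fun _ => 0, by simp, by simp, rfl, ?_⟩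
    simp [pq, QS]
  | succ m ih =>
    intro S hS hc u hu hor z hz h0
    obtain ⟨p, hl⟩ := hor.resolve_left (by omega)
    have hc' := leaf_conn G S hc u p hl
    have hcard : (S.erase u).card = m + 1 := by rw [Finset.card_erase_of_mem hu, hS]; rfl
    have hpe : p ∈ S.erase u := Finset.mem_erase.mpr ⟨hl.2.2.1.ne', hl.2.1⟩
    obtain ⟨x, hx, hx1, hx2⟩ : ∃ x ∈ S.erase u, (m = 0 ∨ ∃ q, Lf G (S.erase u) x q) ∧
        (m = 0 ∨ x ≠ p) := by
      by_cases hm : m = 0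
      · exact ⟨p, hpe, Or.inl hm, Or.inl hm⟩
      · obtain ⟨x, q, hxp, hxl⟩ := leaf_exists_ne G hG (S.erase u) hc' (by omega) p
        exact ⟨x, hxl.1, Or.inr ⟨q, hxl⟩, Or.inr hxp⟩
    obtain ⟨f, hf1, hf2, hf3, hf4⟩ := ih (S.erase u) hcard hc' x hx hx1 (fun k => z (k + 1))
      (fun a b hab => hz (by omega)) (fun k => h0 _)
    refine ⟨ext0 u f, ext0_inj S u f hf1, ext0_le S u f m hf2, ext0_self u f, ?_⟩
    rw [QS_ext0 G S z f u p hl, pq_succ]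
    have hle : min 2 (m + 1) ≤ f p + 1 := by
      rcases hx2 with hm | hne
      · omega
      · have : f p ≠ 0 := by
          intro h
          exact hne (hf1 hx hpe (by rw [hf3, h]))
        omega
    have := mul_le_mul_of_nonneg_left (hz hle) (h0 0)
    linarith

theorem path_order {V : Type} [DecidableEq V] (G : SimpleGraph V)
    (hdeg : ∀ a b c d : V, G.Adj a b → G.Adj a c → G.Adj a d → b ≠ c → b ≠ d → c ≠ d → False) :
    ∀ (m : ℕ) (S : Finset V), S.card = m + 1 → (G.induce (S : Set V)).Connected →
    ∀ u ∈ S, (m = 0 ∨ ∃ p, Lf G S u p) →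
    ∃ f : V → ℕ, Set.InjOn f (S : Set V) ∧ (∀ s ∈ S, f s ≤ m) ∧ f u = 0 ∧
      ∀ a ∈ S, ∀ b ∈ S, G.Adj a b ↔ (f a + 1 = f b ∨ f b + 1 = f a) := by
  intro m
  induction m with
  | zero =>
    intro S hS _ u hu _
    obtain ⟨x, rfl⟩ := Finset.card_eq_one.mp hS
    refine ⟨fun _ => 0, by simp, by simp, rfl, ?_⟩
    simp
  | succ m ih =>
    intro S hS hc u hu hor
    obtain ⟨p, hl⟩ := hor.resolve_left (by omega)
    have hc' := leaf_conn G S hc u p hl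
    have hcard : (S.erase u).card = m + 1 := by rw [Finset.card_erase_of_mem hu, hS]; rfl
    have hpe : p ∈ S.erase u := Finset.mem_erase.mpr ⟨hl.2.2.1.ne', hl.2.1⟩
    have hx1 : m = 0 ∨ ∃ q, Lf G (S.erase u) p q := by
      by_cases hm : m = 0
      · exact Or.inl hm
      · right
        have : Nontrivial ((S.erase u : Finset V) : Set V) := by
          obtain ⟨a, ha, b, hb, hab⟩ := Finset.one_lt_card.mp (by omega : 1 < (S.erase u).card)
          exact ⟨⟨a, ha⟩, ⟨b, hb⟩, by simpa using hab⟩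
        obtain ⟨q, hq⟩ := hc'.preconnected.exists_adj_of_nontrivial ⟨p, hpe⟩
        refine ⟨q, hpe, q.2, hq, ?_⟩
        intro r hr hpr
        by_contra hne
        have hqu : (q : V) ≠ u := Finset.ne_of_mem_erase q.2
        have hru : r ≠ u := Finset.ne_of_mem_erase hr
        exact hdeg p u q r hl.2.2.1.symm hq hpr hqu.symm hru.symm (Ne.symm hne)
    obtain ⟨f, hf1, hf2, hf3, hf4⟩ := ih (S.erase u) hcard hc' p hpe hx1
    refine ⟨ext0 u f, ext0_inj S u f hf1, ext0_le S u f m hf2, ext0_self u f, ?_⟩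
    have key : ∀ b ∈ S, b ≠ u → (G.Adj u b ↔ f b = 0) := by
      intro b hb hbu
      constructor
      · intro h; rw [hl.2.2.2 b hb h, hf3]
      · intro h
        have : b = p := hf1 (Finset.mem_coe.mpr (Finset.mem_erase.mpr ⟨hbu, hb⟩)) hpe (by rw [h, hf3])
        rw [this]; exact hl.2.2.1
    intro a ha b hb
    by_cases h1 : a = u <;> by_cases h2 : b = u
    · subst h1; subst h2; simp
    · subst h1; rw [ext0_self, ext0_ne _ _ h2, key b hb h2]; omega
    · subst h2; rw [ext0_self, ext0_ne _ _ h1, G.adj_comm, key a ha h1]; omega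
    · rw [ext0_ne _ _ h1, ext0_ne _ _ h2, hf4 a (Finset.mem_erase.mpr ⟨h1, ha⟩) b
        (Finset.mem_erase.mpr ⟨h2, hb⟩)]
      omega

theorem three_leaves {V : Type} [Fintype V] [DecidableEq V] (G : SimpleGraph V) (hG : G.IsTree)
    (c x y w : V) (hx : G.Adj c x) (hy : G.Adj c y) (hw : G.Adj c w)
    (hxy : x ≠ y) (hxw : x ≠ w) (hyw : y ≠ w) :
    ∃ a b d p q r, a ≠ b ∧ a ≠ d ∧ b ≠ d ∧ Lf G univ a p ∧ Lf G univ b q ∧ Lf G univ d r := by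
  classical
  have hcard := hG.card_edgeFinset
  have hsum := G.sum_degrees_eq_twice_card_edges
  have hnt : Nontrivial V := ⟨x, y, hxy⟩
  have hpos : ∀ v, 1 ≤ G.degree v := by
    intro v
    obtain ⟨u, hu⟩ := hG.connected.preconnected.exists_adj_of_nontrivial v
    exact (G.degree_pos_iff_exists_adj v).mpr ⟨u, hu⟩
  have hc3 : 3 ≤ G.degree c := by
    rw [← G.card_neighborFinset_eq_degree]
    have : ({x, y, w} : Finset V) ⊆ G.neighborFinset c := by
      intro t ht
      simp at ht
      rcases ht with rfl | rfl | rfl <;> simpa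
    have h2 := Finset.card_le_card this
    rwa [Finset.card_eq_three.mpr ⟨x, y, w, hxy, hxw, hyw, rfl⟩] at h2
  set L := Finset.univ.filter (fun v => G.degree v = 1) with hL
  have hineq : ∀ v, 2 + (if v = c then 1 else 0) ≤ G.degree v + (if G.degree v = 1 then 1 else 0) := by
    intro v
    have := hpos v
    by_cases h1 : v = c
    · subst h1; simp; split_ifs <;> omega
    · simp [h1]; split_ifs <;> omega
  have h4 := Finset.sum_le_sum (s := Finset.univ) (fun v _ => hineq v)
  rw [Finset.sum_add_distrib, Finset.sum_add_distrib, hsum] at h4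
  simp only [Finset.sum_const, Finset.card_univ, smul_eq_mul, Finset.sum_ite_eq', Finset.mem_univ,
    if_true, ← Finset.card_filter] at h4
  have h5 : 2 < L.card := by rw [hL]; omega
  obtain ⟨a, ha, b, hb, d, hd, hab, had, hbd⟩ := Finset.two_lt_card.mp h5
  have hlf : ∀ v ∈ L, ∃ p, Lf G univ v p := by
    intro v hv
    have : G.degree v = 1 := by simpa [hL] using hv
    rw [degree_eq_one_iff_existsUnique_adj] at this
    obtain ⟨p, hp, hp'⟩ := this
    exact ⟨p, by simp, by simp, hp, fun q _ hq => hp' q hq⟩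
  obtain ⟨p, hp⟩ := hlf a ha
  obtain ⟨q, hq⟩ := hlf b hb
  obtain ⟨r, hr⟩ := hlf d hd
  exact ⟨a, b, d, p, q, r, hab, had, hbd, hp, hq, hr⟩

/-- two leaves are not adjacent when the graph is connected on at least three vertices -/
theorem leaves_not_adj {V : Type} [Fintype V] [DecidableEq V] (G : SimpleGraph V)
    (hG : G.Connected) (a b d p q : V) (had : a ≠ d) (hbd : b ≠ d)
    (ha : Lf G univ a p) (hb : Lf G univ b q) : p ≠ b := by
  rintro rfl
  have hqa : a = q := hb.2.2.2 a (by simp) ha.2.2.1.symm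
  subst hqa
  have hreach : ∀ {u v : V} (w : G.Walk u v), (u = a ∨ u = p) → (v = a ∨ v = p) := by
    intro u v w
    induction w with
    | nil => exact id
    | cons h _ ih =>
      rintro (rfl | rfl)
      · exact ih (Or.inr (ha.2.2.2 _ (by simp) h))
      · exact ih (Or.inl (hb.2.2.2 _ (by simp) h))
  obtain ⟨w⟩ := hG.preconnected a d
  rcases hreach w (Or.inl rfl) with h | h
  · exact had h.symm
  · exact hbd h.symm

theorem lf_erase {V : Type} [DecidableEq V] (G : SimpleGraph V) (S : Finset V)
    (u p x : V) (h : Lf G S u p) (h1 : u ≠ x) (h2 : p ≠ x) : Lf G (S.erase x) u p :=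
  ⟨Finset.mem_erase.mpr ⟨h1, h.1⟩, Finset.mem_erase.mpr ⟨h2, h.2.1⟩, h.2.2.1,
    fun q hq hq' => h.2.2.2 q (Finset.mem_of_mem_erase hq) hq'⟩

theorem strong_aux {V : Type} [Fintype V] [DecidableEq V] (G : SimpleGraph V) (hG : G.IsTree)
    (k : ℕ) (hk : Fintype.card V = k + 5)
    (a b d p q r : V) (hab : a ≠ b) (had : a ≠ d) (hbd : b ≠ d)
    (ha : Lf G univ a p) (hb : Lf G univ b q) (hd : Lf G univ d r)
    (l s : V) (hl : Lf G (((univ.erase a).erase b).erase d) l s)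
    (hlp : l ≠ p) (hlr : l ≠ r)
    (z : ℕ → ℝ) (hz : Monotone z) (h0 : ∀ k, 0 ≤ z k) (hz0 : 0 < z 0) (hz2 : z 2 < z 4) :
    ∃ f : V → ℕ, Function.Injective f ∧ (∀ v, f v < k + 5) ∧
      2 * pq (k + 5) z < QS G univ (fun v => z (f v)) := by
  have hpb := leaves_not_adj G hG.connected a b d p q had hbd ha hb
  have hpd := leaves_not_adj G hG.connected a d b p r hab hbd.symm ha hd
  have hqa := leaves_not_adj G hG.connected b a d q p hbd had hb ha
  have hqd := leaves_not_adj G hG.connected b d a q r hab.symm had.symm hb hd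
  have hra := leaves_not_adj G hG.connected d a b r p hbd.symm hab hd ha
  have hrb := leaves_not_adj G hG.connected d b a r q had.symm hab.symm hd hb
  have hc0 : (G.induce ((univ : Finset V) : Set V)).Connected := by
    rw [Finset.coe_univ]
    exact (SimpleGraph.induceUnivIso G).connected_iff.mpr hG.connected
  have hb1 := lf_erase G _ b q a hb hab.symm hqa
  have hd2 := lf_erase G _ d r b (lf_erase G _ d r a hd had.symm hra) hbd.symm hrb
  have hc1 := leaf_conn G _ hc0 a p ha
  have hc2 := leaf_conn G _ hc1 b q hb1
  have hc3 := leaf_conn G _ hc2 d r hd2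
  have hcard : (((univ.erase a).erase b).erase d).card = k + 1 + 1 := by
    rw [Finset.card_erase_of_mem hd2.1, Finset.card_erase_of_mem hb1.1,
      Finset.card_erase_of_mem (Finset.mem_univ a), Finset.card_univ, hk]
    omega
  obtain ⟨f, hf1, hf2, hf3, hf4⟩ := weak_order G hG.isAcyclic (k + 1) _ hcard hc3 l hl.1
    (Or.inr ⟨s, hl⟩) (fun j => z (j + 1 + 1 + 1)) (fun a b hab => hz (by omega)) (fun _ => h0 _)
  have hpm : p ∈ ((univ.erase a).erase b).erase d := by
    simp [hpb, hpd, ha.2.2.1.ne']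
  have hqm : q ∈ ((univ.erase a).erase b).erase d := by
    simp [hqa, hqd, hb.2.2.1.ne']
  have hrm : r ∈ ((univ.erase a).erase b).erase d := by
    simp [hra, hrb, hd.2.2.1.ne']
  have hfp : f p ≠ 0 := fun h => hlp (hf1 hl.1 hpm (by rw [hf3, h]))
  have hfr : f r ≠ 0 := fun h => hlr (hf1 hl.1 hrm (by rw [hf3, h]))
  refine ⟨ext0 a (ext0 b (ext0 d f)), ?_, ?_, ?_⟩
  · have := ext0_inj univ a _ (ext0_inj _ b _ (ext0_inj _ d f hf1))
    rw [Finset.coe_univ] at this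
    exact Set.injOn_univ.mp this
  · intro v
    have := ext0_le univ a _ _ (ext0_le _ b _ _ (ext0_le _ d f _ hf2)) v (by simp)
    omega
  · rw [QS_ext0 G _ z _ a p ha, QS_ext0 G _ (fun k => z (k + 1)) _ b q hb1,
      QS_ext0 G _ (fun k => z (k + 1 + 1)) _ d r hd2]
    rw [ext0_ne _ _ hpb, ext0_ne _ _ hpd, ext0_ne _ _ hqd]
    rw [show k + 5 = (k + 3) + 2 from rfl, pq_succ, show k + 3 + 1 = (k + 2) + 2 from rfl, pq_succ,
      show k + 2 + 1 = (k + 1) + 2 from rfl, pq_succ]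
    simp only [show min 2 (k + 2 + 2) = 2 by omega, show min 2 (k + 2 + 1) = 2 by omega,
      show min 2 (k + 1 + 2) = 2 by omega, show min 2 (k + 3 + 1) = 2 by omega,
      show min 2 (k + 1 + 1) = 2 by omega]
    have e1 : z 0 * z 2 < z 0 * z (f p + 1 + 1 + 1) :=
      mul_lt_mul_of_pos_left (hz2.trans_le (hz (by omega))) hz0
    have e2 : z 1 * z 3 ≤ z 1 * z (f q + 1 + 1 + 1) :=
      mul_le_mul_of_nonneg_left (hz (by omega)) (h0 _)
    have e3 : z 2 * z 4 ≤ z 2 * z (f r + 1 + 1 + 1) :=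
      mul_le_mul_of_nonneg_left (hz (by omega)) (h0 _)
    simp only [zero_add, Nat.reduceAdd] at *
    linarith

theorem strong_order {V : Type} [Fintype V] [DecidableEq V] (G : SimpleGraph V) (hG : G.IsTree)
    (k : ℕ) (hk : Fintype.card V = k + 5)
    (a b d p q r : V) (hab : a ≠ b) (had : a ≠ d) (hbd : b ≠ d)
    (ha : Lf G univ a p) (hb : Lf G univ b q) (hd : Lf G univ d r)
    (z : ℕ → ℝ) (hz : Monotone z) (h0 : ∀ k, 0 ≤ z k) (hz0 : 0 < z 0) (hz2 : z 2 < z 4) :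
    ∃ f : V → ℕ, Function.Injective f ∧ (∀ v, f v < k + 5) ∧
      2 * pq (k + 5) z < QS G univ (fun v => z (f v)) := by
  have hqa := leaves_not_adj G hG.connected b a d q p hbd had hb ha
  have hra := leaves_not_adj G hG.connected d a b r p hbd.symm hab hd ha
  have hrb := leaves_not_adj G hG.connected d b a r q had.symm hab.symm hd hb
  have hc0 : (G.induce ((univ : Finset V) : Set V)).Connected := by
    rw [Finset.coe_univ]
    exact (SimpleGraph.induceUnivIso G).connected_iff.mpr hG.connected
  have hb1 := lf_erase G _ b q a hb hab.symm hqa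
  have hd2 := lf_erase G _ d r b (lf_erase G _ d r a hd had.symm hra) hbd.symm hrb
  have hc1 := leaf_conn G _ hc0 a p ha
  have hc2 := leaf_conn G _ hc1 b q hb1
  have hc3 := leaf_conn G _ hc2 d r hd2
  have hcard : (((univ.erase a).erase b).erase d).card = k + 1 + 1 := by
    rw [Finset.card_erase_of_mem hd2.1, Finset.card_erase_of_mem hb1.1,
      Finset.card_erase_of_mem (Finset.mem_univ a), Finset.card_univ, hk]
    omega
  have hex : ∃ l s, Lf G (((univ.erase a).erase b).erase d) l s ∧
      ((l ≠ p ∧ l ≠ r) ∨ (l ≠ p ∧ l ≠ q) ∨ (l ≠ q ∧ l ≠ r)) := by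
    obtain ⟨u, v, p', q', huv, hu, hv⟩ := leaf_exists G hG.isAcyclic _ hc3 (by omega)
    by_cases h1 : (u ≠ p ∧ u ≠ r) ∨ (u ≠ p ∧ u ≠ q) ∨ (u ≠ q ∧ u ≠ r)
    · exact ⟨u, p', hu, h1⟩
    · refine ⟨v, q', hv, ?_⟩
      by_contra h2
      grind
  obtain ⟨l, s, hl, h | h | h⟩ := hex
  · exact strong_aux G hG k hk a b d p q r hab had hbd ha hb hd l s hl h.1 h.2 z hz h0 hz0 hz2
  · have e : ((univ.erase a).erase b).erase d = ((univ.erase a).erase d).erase b :=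
      Finset.erase_right_comm
    rw [e] at hl
    exact strong_aux G hG k hk a d b p r q had hab hbd.symm ha hd hb l s hl h.1 h.2 z hz h0 hz0 hz2
  · have e : ((univ.erase a).erase b).erase d = ((univ.erase b).erase a).erase d := by
      rw [Finset.erase_right_comm (s := univ)]
    rw [e] at hl
    exact strong_aux G hG k hk b a d q p r hab.symm hbd had hb ha hd l s hl h.1 h.2 z hz h0 hz0 hz2

theorem min_principle (N : ℕ) (x : ℕ → ℝ) (μ : ℝ) (hμ : 2 < μ)
    (h : ∀ i ≤ N, x i < 0 → ∃ a b, a + b ≤ μ * x i ∧ (0 ≤ a ∨ ∃ j ≤ N, x j ≤ a) ∧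
      (0 ≤ b ∨ ∃ j ≤ N, x j ≤ b)) : ∀ i ≤ N, 0 ≤ x i := by
  obtain ⟨k, hk, hmin⟩ := Finset.exists_min_image (Finset.range (N + 1)) x ⟨0, by simp⟩
  have hk' : k ≤ N := by simpa [Nat.lt_succ_iff] using hk
  have hm : ∀ j ≤ N, x k ≤ x j := fun j hj => hmin j (by simpa [Nat.lt_succ_iff] using hj)
  intro i hi
  by_contra hneg
  have hkneg : x k < 0 := lt_of_le_of_lt (hm i hi) (not_le.mp hneg)
  obtain ⟨a, b, hab, ha, hb⟩ := h k hk' hkneg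
  have ha' : x k ≤ a := by
    rcases ha with ha | ⟨j, hj, hja⟩
    · linarith
    · exact (hm j hj).trans hja
  have hb' : x k ≤ b := by
    rcases hb with hb | ⟨j, hj, hjb⟩
    · linarith
    · exact (hm j hj).trans hjb
  nlinarith

/-- min principle for the path -/
theorem min_path (n : ℕ) (x : ℕ → ℝ) (μ : ℝ) (hμ : 2 < μ) (h0 : x 0 = 0) (h1 : x (n + 1) = 0)
    (h : ∀ i < n, x i + x (i + 2) ≤ μ * x (i + 1)) : ∀ i ≤ n + 1, 0 ≤ x i := by
  apply min_principle (n + 1) x μ hμ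
  intro i hi hneg
  rcases Nat.eq_zero_or_pos i with rfl | hpos
  · linarith
  by_cases hi' : i = n + 1
  · subst hi'; linarith
  obtain ⟨j, rfl⟩ : ∃ j, i = j + 1 := ⟨i - 1, by omega⟩
  exact ⟨x j, x (j + 2), h j (by omega), Or.inr ⟨j, by omega, le_rfl⟩,
    Or.inr ⟨j + 2, by omega, le_rfl⟩⟩

theorem path_seq (n : ℕ) (hn : 5 ≤ n) (x : ℕ → ℝ) (μ S : ℝ) (hμ : 2 < μ) (hS : 0 < S)
    (h0 : x 0 = 0) (h1 : x (n + 1) = 0)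
    (h : ∀ i < n, μ * x (i + 1) = S + x i + x (i + 2)) :
    (∀ i < n, 0 < x (i + 1)) ∧ (∀ i ≤ n + 1, x (n + 1 - i) = x i) ∧
    (∀ i, 2 * i ≤ n → x i ≤ x (i + 1)) ∧ x 2 < x 3 := by
  have hnn := min_path n x μ hμ h0 h1 (fun i hi => by rw [h i hi]; linarith)
  have hpos : ∀ i < n, 0 < x (i + 1) := by
    intro i hi
    have e := h i hi
    have e1 := hnn i (by omega)
    have e2 := hnn (i + 2) (by omega)
    by_contra hc
    nlinarith
  have hrev : ∀ i < n, μ * x (n + 1 - (i + 1)) = S + x (n + 1 - i) + x (n + 1 - (i + 2)) := by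
    intro i hi
    have e := h (n - 1 - i) (by omega)
    rw [show n - 1 - i + 1 = n + 1 - (i + 1) by omega, show n - 1 - i = n + 1 - (i + 2) by omega,
      show n + 1 - (i + 2) + 2 = n + 1 - i by omega] at e
    linarith
  have hle1 := min_path n (fun i => x i - x (n + 1 - i)) μ hμ (by simp [h0, h1]) (by simp [h0, h1])
    (fun i hi => by linarith [h i hi, hrev i hi])
  have hle2 := min_path n (fun i => x (n + 1 - i) - x i) μ hμ (by simp [h0, h1]) (by simp [h0, h1])
    (fun i hi => by linarith [h i hi, hrev i hi])
  have hsym : ∀ i ≤ n + 1, x (n + 1 - i) = x i := by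
    intro i hi
    have := hle1 i hi
    have := hle2 i hi
    linarith
  have heq : ∀ i, i + 1 < n → μ * (x (i + 2) - x (i + 1)) = (x (i + 1) - x i) + (x (i + 3) - x (i + 2)) := by
    intro i hi
    have e1 := h i (by omega)
    have e2 := h (i + 1) hi
    rw [show i + 1 + 1 = i + 2 by omega, show i + 1 + 2 = i + 3 by omega] at e2
    linarith
  have hmono : ∀ i ≤ n / 2, 0 ≤ x (i + 1) - x i := by
    apply min_principle (n / 2) (fun i => x (i + 1) - x i) μ hμ
    intro i hi hneg
    rcases Nat.eq_zero_or_pos i with rfl | hip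
    · have := hpos 0 (by omega)
      rw [h0] at hneg
      linarith
    obtain ⟨j, rfl⟩ : ∃ j, i = j + 1 := ⟨i - 1, by omega⟩
    refine ⟨x (j + 1) - x j, x (j + 3) - x (j + 2), (heq j (by omega)).ge,
      Or.inr ⟨j, by omega, le_rfl⟩, ?_⟩
    by_cases hj : j + 2 ≤ n / 2
    · exact Or.inr ⟨j + 2, hj, le_rfl⟩
    · left
      by_cases hpar : n = 2 * (j + 1)
      · have := hsym (j + 1) (by omega)
        rw [show n + 1 - (j + 1) = j + 1 + 1 by omega] at this
        linarith
      · have e1 := hsym (j + 1) (by omega)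
        rw [show n + 1 - (j + 1) = j + 3 by omega] at e1
        rw [e1]
        linarith [hneg]
  refine ⟨hpos, hsym, fun i hi => by linarith [hmono i (by omega)], ?_⟩
  have e1 := hmono 1 (by omega)
  have e2 := hmono 2 (by omega)
  have e3 : 0 ≤ x 4 - x 3 ∨ x 4 = x 2 := by
    by_cases hn6 : 6 ≤ n
    · exact Or.inl (hmono 3 (by omega))
    · have : n = 5 := by omega
      subst this
      exact Or.inr (hsym 2 (by omega))
  have q1 := heq 0 (by omega)
  have q2 := heq 1 (by omega)
  have p1 := hpos 0 (by omega)
  simp only [Nat.reduceAdd, zero_add] at *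
  by_contra hc
  have z2 : x 3 = x 2 := by linarith
  rw [z2] at q1 q2 e3
  have z1 : x 2 - x 1 = 0 := by
    rcases e3 with e3 | e3
    · nlinarith
    · rw [e3] at q2; nlinarith
  rw [z1] at q1
  rw [h0] at q1
  linarith

theorem dist_nonadj {n : ℕ} (G : SimpleGraph (Fin n)) (i j : Fin n) (hij : i ≠ j)
    (h : ¬ G.Adj i j) : Gᶜ.dist i j = 1 := by
  rw [SimpleGraph.dist_eq_one_iff_adj, SimpleGraph.compl_adj]
  exact ⟨hij, h⟩

theorem dist_adj_ge {n : ℕ} (G : SimpleGraph (Fin n)) (i j : Fin n)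
    (h : G.Adj i j) (hr : Gᶜ.Reachable i j) : 2 ≤ Gᶜ.dist i j := by
  have h0 : Gᶜ.dist i j ≠ 0 := by
    intro h0
    exact h.ne ((hr.dist_eq_zero_iff).mp h0)
  have h1 : Gᶜ.dist i j ≠ 1 := by
    intro h1
    rw [SimpleGraph.dist_eq_one_iff_adj, SimpleGraph.compl_adj] at h1
    exact h1.2 h
  omega

theorem dist_path {n : ℕ} (hn : 5 ≤ n) (i j : Fin n) (h : (pathGraph n).Adj i j) :
    (pathGraph n)ᶜ.dist i j = 2 := by
  obtain ⟨w, hwi, hwj⟩ : ∃ w : Fin n, (pathGraph n)ᶜ.Adj i w ∧ (pathGraph n)ᶜ.Adj w j := by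
    simp only [SimpleGraph.compl_adj, pathGraph_adj, Fin.ext_iff, ne_eq] at h ⊢
    have hi := i.2
    have hj := j.2
    by_cases h3 : max i.1 j.1 + 2 < n
    · exact ⟨⟨max i.1 j.1 + 2, h3⟩, by simp only []; omega, by simp only []; omega⟩
    · exact ⟨⟨min i.1 j.1 - 2, by omega⟩, by simp only []; omega, by simp only []; omega⟩
  have hle := SimpleGraph.dist_le (Walk.cons hwi (Walk.cons hwj Walk.nil))
  have := dist_adj_ge (pathGraph n) i j h ⟨Walk.cons hwi (Walk.cons hwj Walk.nil)⟩
  simp at hle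
  omega

/-- no triangles -/
theorem no_tri {n : ℕ} (T : SimpleGraph (Fin n)) (hT : T.IsAcyclic) (a b c : Fin n)
    (h1 : T.Adj a b) (h2 : T.Adj b c) (h3 : T.Adj a c) : False := by
  have hp1 : (Walk.cons h1 (Walk.cons h2 Walk.nil)).IsPath := by
    simp [h1.ne, h2.ne, h3.ne]
  have hp2 : (Walk.cons h3 Walk.nil).IsPath := by simp [h3.ne]
  have := (hT.subsingleton_path _ _).elim ⟨_, hp1⟩ ⟨_, hp2⟩
  have := congrArg (fun p : T.Path a c => p.1.length) this
  simp at this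

/-- no four-cycles -/
theorem no_four {n : ℕ} (T : SimpleGraph (Fin n)) (hT : T.IsAcyclic) (a b c d : Fin n)
    (h1 : T.Adj a b) (h2 : T.Adj b c) (h3 : T.Adj c d) (h4 : T.Adj a d) (hac : a ≠ c)
    (hbd : b ≠ d) : False := by
  have hp1 : (Walk.cons h1 (Walk.cons h2 (Walk.cons h3 Walk.nil))).IsPath := by
    simp [h1.ne, h2.ne, h3.ne, h4.ne, hac, hbd]
  have hp2 : (Walk.cons h4 Walk.nil).IsPath := by simp [h4.ne]
  have := (hT.subsingleton_path _ _).elim ⟨_, hp1⟩ ⟨_, hp2⟩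
  have := congrArg (fun p : T.Path a d => p.1.length) this
  simp at this

theorem star_of_dom {n : ℕ} (T : SimpleGraph (Fin n)) (hT : T.IsAcyclic) (c : Fin n)
    (h : ∀ v, v ≠ c → T.Adj c v) : IsStar T := by
  refine ⟨c, fun a b => ⟨fun hab => ⟨hab.ne, ?_⟩, ?_⟩⟩
  · by_contra hc
    push Not at hc
    exact no_tri T hT c a b (h a hc.1) hab (h b hc.2)
  · rintro ⟨hab, rfl | rfl⟩
    · exact h b hab.symm
    · exact (h a hab).symm

theorem compl_reach {n : ℕ} (T : SimpleGraph (Fin n)) (hT : T.IsAcyclic) (hs : ¬ IsStar T)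
    (a b : Fin n) (hab : T.Adj a b) : Tᶜ.Reachable a b := by
  have ha : ∃ v, v ≠ a ∧ ¬ T.Adj a v := by
    by_contra hc; push Not at hc; exact hs (star_of_dom T hT a hc)
  have hb : ∃ v, v ≠ b ∧ ¬ T.Adj b v := by
    by_contra hc; push Not at hc; exact hs (star_of_dom T hT b hc)
  obtain ⟨w, hwa, hw⟩ := ha
  obtain ⟨u, hub, hu⟩ := hb
  have hwb : w ≠ b := by rintro rfl; exact hw hab
  have hua : u ≠ a := by rintro rfl; exact hu hab.symm
  have c1 : Tᶜ.Adj a w := by rw [SimpleGraph.compl_adj]; exact ⟨hwa.symm, hw⟩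
  have c2 : Tᶜ.Adj u b := by rw [SimpleGraph.compl_adj]; exact ⟨hub, fun h => hu h.symm⟩
  by_cases h1 : T.Adj b w
  · by_cases h2 : T.Adj a u
    · have hwu : w ≠ u := by rintro rfl; exact hw h2
      have c3 : Tᶜ.Adj w u := by
        rw [SimpleGraph.compl_adj]
        exact ⟨hwu, fun h => no_four T hT a b w u hab h1 h h2 hwa.symm hub.symm⟩
      exact c1.reachable.trans (c3.reachable.trans c2.reachable)
    · have c3 : Tᶜ.Adj a u := by rw [SimpleGraph.compl_adj]; exact ⟨hua.symm, h2⟩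
      exact c3.reachable.trans c2.reachable
  · have c3 : Tᶜ.Adj w b := by rw [SimpleGraph.compl_adj]; exact ⟨hwb, fun h => h1 h.symm⟩
    exact c1.reachable.trans c3.reachable

open Classical in
/-- The matrix `J - I + A`. -/
def JA {n : ℕ} (G : SimpleGraph (Fin n)) (i j : Fin n) : ℝ :=
  (1 - if i = j then 1 else 0) + if G.Adj i j then 1 else 0

theorem distM_path {n : ℕ} (hn : 5 ≤ n) (i j : Fin n) :
    distM (pathGraph n)ᶜ i j = JA (pathGraph n) i j := by
  unfold distM JA
  by_cases hij : i = j
  · subst hij; simp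
  by_cases h : (pathGraph n).Adj i j
  · rw [dist_path hn i j h]; simp [hij, h]; norm_num
  · rw [dist_nonadj _ i j hij h]; simp [hij, h]

theorem distM_ge {n : ℕ} (T : SimpleGraph (Fin n)) (hT : T.IsAcyclic) (hs : ¬ IsStar T)
    (i j : Fin n) : JA T i j ≤ distM Tᶜ i j := by
  unfold distM JA
  by_cases hij : i = j
  · subst hij; simp
  by_cases h : T.Adj i j
  · have := dist_adj_ge T i j h (compl_reach T hT hs i j h)
    have : (2 : ℝ) ≤ (Tᶜ.dist i j : ℝ) := by exact_mod_cast this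
    simp only [hij, h, if_true, if_false]; linarith
  · rw [dist_nonadj _ i j hij h]; simp [hij, h]

theorem JA_quad {n : ℕ} (G : SimpleGraph (Fin n)) (y : Fin n → ℝ) :
    ∑ i, y i * ∑ j, JA G i j * y j = (∑ i, y i) ^ 2 - ∑ i, y i ^ 2 + QS G univ y := by
  classical
  have h1 : ∀ i, y i * ∑ j, JA G i j * y j = y i * (∑ j, y j) - y i ^ 2
      + ∑ j, if G.Adj i j then y i * y j else 0 := by
    intro i
    have : ∀ j, JA G i j * y j = y j - (if i = j then y j else 0)
        + (if G.Adj i j then y j else 0) := by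
      intro j
      unfold JA
      split_ifs <;> ring
    simp only [this]
    rw [Finset.sum_add_distrib, Finset.sum_sub_distrib, Finset.sum_ite_eq, if_pos (mem_univ _),
      mul_add, mul_sub, Finset.mul_sum (a := y i) (f := fun j => if G.Adj i j then y j else 0)]
    simp only [mul_ite, mul_zero]
    ring
  simp only [h1]
  rw [Finset.sum_add_distrib, Finset.sum_sub_distrib, ← Finset.sum_mul]
  unfold QS
  ring_nf

/-- one-indexed extension by zero of a vector -/
def xx {n : ℕ} (v : Fin n → ℝ) (k : ℕ) : ℝ := ∑ j : Fin n, if j.1 + 1 = k then v j else 0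

theorem xx_succ {n : ℕ} (v : Fin n → ℝ) (i : Fin n) : xx v (i.1 + 1) = v i := by
  unfold xx
  rw [Finset.sum_eq_single i]
  · simp
  · intro b _ hb
    rw [if_neg]
    intro h
    exact hb (Fin.ext (by omega))
  · simp

theorem xx_zero {n : ℕ} (v : Fin n → ℝ) : xx v 0 = 0 := by
  unfold xx
  simp

theorem xx_last {n : ℕ} (v : Fin n → ℝ) : xx v (n + 1) = 0 := by
  unfold xx
  refine Finset.sum_eq_zero fun j _ => ?_
  rw [if_neg]
  have := j.2
  omega

theorem path_mulVec {n : ℕ} (hn : 5 ≤ n) (v : Fin n → ℝ) (i : Fin n) :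
    ((distM (pathGraph n)ᶜ).mulVec v) i = (∑ j, v j) - v i + xx v i.1 + xx v (i.1 + 2) := by
  classical
  have h : ((distM (pathGraph n)ᶜ).mulVec v) i = ∑ j, (v j - (if i = j then v j else 0)
      + (if j.1 + 1 = i.1 then v j else 0) + (if j.1 + 1 = i.1 + 2 then v j else 0)) := by
    unfold Matrix.mulVec dotProduct
    refine Finset.sum_congr rfl fun j _ => ?_
    change distM (pathGraph n)ᶜ i j * v j = _
    rw [distM_path hn]
    unfold JA
    simp only [pathGraph_adj]
    have hij : i = j ↔ i.1 = j.1 := Fin.ext_iff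
    simp only [hij]
    split_ifs <;> first | omega | ring
  rw [h, Finset.sum_add_distrib, Finset.sum_add_distrib, Finset.sum_sub_distrib]
  simp [xx]

theorem quad_mulVec {n : ℕ} (M : Matrix (Fin n) (Fin n) ℝ) (G : SimpleGraph (Fin n))
    (h : ∀ i j, M i j = JA G i j) (y : Fin n → ℝ) :
    ∑ i, y i * (M.mulVec y) i = (∑ i, y i) ^ 2 - ∑ i, y i ^ 2 + QS G univ y := by
  rw [← JA_quad]
  refine Finset.sum_congr rfl fun i _ => ?_
  congr 1
  unfold Matrix.mulVec dotProduct
  exact Finset.sum_congr rfl fun j _ => congrArg (· * y j) (h i j)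

/-- folding permutation -/
def pfold {n : ℕ} (k : Fin n) : Fin n :=
  ⟨if k.1 % 2 = 0 then k.1 / 2 else n - 1 - k.1 / 2, by have := k.2; split_ifs <;> omega⟩

theorem pfold_bij {n : ℕ} : Function.Bijective (pfold (n := n)) := by
  apply Function.Injective.bijective_of_finite
  intro a b hab
  have ha := a.2
  have hb := b.2
  unfold pfold at hab
  simp only [Fin.mk.injEq] at hab
  apply Fin.ext
  split_ifs at hab <;> omega

theorem pfold_adj {n : ℕ} (a b : Fin n) : (pathGraph n).Adj (pfold a) (pfold b) ↔
    ((a.1 < n - 1 ∧ b.1 = min (a.1 + 2) (n - 1)) ∨ (b.1 < n - 1 ∧ a.1 = min (b.1 + 2) (n - 1))) := by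
  have ha := a.2
  have hb := b.2
  rw [pathGraph_adj]
  unfold pfold
  simp only
  split_ifs <;> omega

theorem pq_eq {n : ℕ} (z : ℕ → ℝ) : ∑ a : Fin n, ∑ b : Fin n,
    (if a.1 < n - 1 ∧ b.1 = min (a.1 + 2) (n - 1) then z a.1 * z b.1 else 0) = pq n z := by
  unfold pq
  have h1 : ∀ a : Fin n, (∑ b : Fin n,
    (if a.1 < n - 1 ∧ b.1 = min (a.1 + 2) (n - 1) then z a.1 * z b.1 else 0)) =
      if a.1 < n - 1 then z a.1 * z (min (a.1 + 2) (n - 1)) else 0 := by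
    intro a
    have ha := a.2
    rw [Finset.sum_eq_single (⟨min (a.1 + 2) (n - 1), by omega⟩ : Fin n)]
    · simp
    · intro b _ hb
      rw [if_neg]
      rintro ⟨_, h⟩
      exact hb (Fin.ext h)
    · simp
  simp only [h1]
  rw [Fin.sum_univ_eq_sum_range (fun k => if k < n - 1 then z k * z (min (k + 2) (n - 1)) else 0) n,
    ← Finset.sum_filter]
  congr 1
  ext k
  simp
  omega

theorem QS_fold {n : ℕ} (v : Fin n → ℝ) (z : ℕ → ℝ) (h : ∀ k, v (pfold k) = z k.1) :
    QS (pathGraph n) univ v = 2 * pq n z := by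
  classical
  unfold QS
  rw [← (Equiv.ofBijective _ (pfold_bij (n := n))).sum_comp]
  have : ∀ a : Fin n, (∑ b : Fin n, if (pathGraph n).Adj (pfold a) b then v (pfold a) * v b else 0)
      = ∑ b : Fin n, ((if a.1 < n - 1 ∧ b.1 = min (a.1 + 2) (n - 1) then z a.1 * z b.1 else 0)
        + (if b.1 < n - 1 ∧ a.1 = min (b.1 + 2) (n - 1) then z b.1 * z a.1 else 0)) := by
    intro a
    rw [← (Equiv.ofBijective _ (pfold_bij (n := n))).sum_comp]
    refine Finset.sum_congr rfl fun b _ => ?_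
    simp only [Equiv.ofBijective_apply, pfold_adj, h]
    have ha := a.2
    have hb := b.2
    split_ifs <;> first | omega | ring
  simp only [Equiv.ofBijective_apply]
  calc _ = _ := Finset.sum_congr rfl fun a _ => this a
    _ = _ := by
      simp only [Finset.sum_add_distrib]
      rw [pq_eq, Finset.sum_comm, pq_eq]
      ring

theorem sum_fold {n : ℕ} (v : Fin n → ℝ) (z : ℕ → ℝ) (h : ∀ k, v (pfold k) = z k.1) (g : ℝ → ℝ) :
    ∑ i, g (v i) = ∑ k ∈ Finset.range n, g (z k) := by
  rw [← (Equiv.ofBijective _ (pfold_bij (n := n))).sum_comp]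
  simp only [Equiv.ofBijective_apply, h]
  exact Fin.sum_univ_eq_sum_range (fun k => g (z k)) n

theorem path_eig (n : ℕ) (hn : 5 ≤ n) : ∃ z : ℕ → ℝ, Monotone z ∧ (∀ k, 0 ≤ z k) ∧ 0 < z 0 ∧
    z 2 < z 4 ∧ lam1 (distM (pathGraph n)ᶜ) * ∑ k ∈ Finset.range n, z k ^ 2
      = (∑ k ∈ Finset.range n, z k) ^ 2 - ∑ k ∈ Finset.range n, z k ^ 2 + 2 * pq n z := by
  classical
  set M := distM (pathGraph n)ᶜ with hM
  obtain ⟨⟨v, hv0, hv⟩, hray⟩ := lam1_spec (by omega) M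
    (fun i j => by simp [hM, distM, SimpleGraph.dist_comm])
  set lam := lam1 M with hlam
  have hJA : ∀ i j, M i j = JA (pathGraph n) i j := fun i j => distM_path hn i j
  have hlam4 : 4 ≤ lam := by
    have h1 := hray (fun _ => 1)
    rw [quad_mulVec M _ hJA] at h1
    have h2 : 0 ≤ QS (pathGraph n) univ (fun _ => 1) := by
      unfold QS
      refine Finset.sum_nonneg fun a _ => Finset.sum_nonneg fun b _ => ?_
      split_ifs <;> norm_num
    simp at h1
    have h3 : (5 : ℝ) ≤ n := by exact_mod_cast hn
    nlinarith
  have hμ : 2 < lam + 1 := by linarith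
  have heq : ∀ w : Fin n → ℝ, M.mulVec w = lam • w →
      ∀ i < n, (lam + 1) * xx w (i + 1) = (∑ j, w j) + xx w i + xx w (i + 2) := by
    intro w hw i hi
    have h1 := congrFun hw ⟨i, hi⟩
    rw [path_mulVec hn] at h1
    have h2 := xx_succ w ⟨i, hi⟩
    simp only [Pi.smul_apply, smul_eq_mul] at h1 h2
    rw [h2]
    linarith
  have hS0 : (∑ j, v j) ≠ 0 := by
    intro hS
    have e := heq v hv
    have n1 := min_path n (xx v) _ hμ (xx_zero v) (xx_last v)
      (fun i hi => by rw [e i hi, hS]; linarith)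
    have n2 := min_path n (fun k => - xx v k) _ hμ (by simp [xx_zero v]) (by simp [xx_last v])
      (fun i hi => by have := e i hi; rw [hS] at this; linarith)
    apply hv0
    ext i
    have hi := i.2
    have a1 := n1 (i.1 + 1) (by omega)
    have a2 := n2 (i.1 + 1) (by omega)
    rw [xx_succ] at a1 a2
    simp only [Pi.zero_apply]
    linarith
  obtain ⟨w, hw, hwS⟩ : ∃ w : Fin n → ℝ, M.mulVec w = lam • w ∧ 0 < ∑ j, w j := by
    rcases lt_or_gt_of_ne hS0 with h | h
    · refine ⟨-v, by rw [Matrix.mulVec_neg, hv, smul_neg], ?_⟩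
      simp only [Pi.neg_apply, Finset.sum_neg_distrib]
      linarith
    · exact ⟨v, hv, h⟩
  obtain ⟨hpos, hsym, hmono, hstrict⟩ := path_seq n hn (xx w) (lam + 1) _ hμ hwS (xx_zero w)
    (xx_last w) (heq w hw)
  set z : ℕ → ℝ := fun k => xx w (min k (n - 1) / 2 + 1) with hz
  have hzw : ∀ k : Fin n, w (pfold k) = z k.1 := by
    intro k
    have hk := k.2
    rw [← xx_succ w (pfold k)]
    simp only [hz]
    rw [show min k.1 (n - 1) = k.1 by omega]
    unfold pfold
    simp only
    split_ifs with hpar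
    · rfl
    · rw [← hsym (k.1 / 2 + 1) (by omega)]
      congr 1
      omega
  refine ⟨z, ?_, ?_, ?_, ?_, ?_⟩
  · apply monotone_nat_of_le_succ
    intro k
    simp only [hz]
    by_cases h1 : min (k + 1) (n - 1) / 2 = min k (n - 1) / 2
    · rw [h1]
    · rw [show min (k + 1) (n - 1) / 2 = min k (n - 1) / 2 + 1 by omega]
      exact hmono _ (by omega)
  · intro k
    exact (hpos _ (by omega)).le
  · exact hpos _ (by omega)
  · simp only [hz]
    rw [show min 2 (n - 1) = 2 by omega, show min 4 (n - 1) = 4 by omega]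
    exact hstrict
  · have h1 := quad_mulVec M _ hJA w
    rw [hw, QS_fold w z hzw, sum_fold w z hzw (fun t => t ^ 2), sum_fold w z hzw (fun t => t)] at h1
    rw [← h1, ← sum_fold w z hzw (fun t => t ^ 2), Finset.mul_sum]
    refine Finset.sum_congr rfl fun i _ => ?_
    simp only [Pi.smul_apply, smul_eq_mul]
    ring

theorem stmt_10 (n : ℕ) (hn : 4 ≤ n) (T : SimpleGraph (Fin n)) (hT : T.IsTree)
    (hstar : ¬ IsStar T) (hpath : ¬ Nonempty (T ≃g SimpleGraph.pathGraph n)) :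
    lam1 (distM Tᶜ) > lam1 (distM (SimpleGraph.pathGraph n)ᶜ) := by
  classical
  have hc0 : (T.induce ((univ : Finset (Fin n)) : Set (Fin n))).Connected := by
    rw [Finset.coe_univ]
    exact (SimpleGraph.induceUnivIso T).connected_iff.mpr hT.connected
  -- a vertex of degree at least three
  have hdeg : ∃ a b c d : Fin n, T.Adj a b ∧ T.Adj a c ∧ T.Adj a d ∧ b ≠ c ∧ b ≠ d ∧ c ≠ d := by
    by_contra hcon
    apply hpath
    obtain ⟨u, _, p, _, _, hu, _⟩ := leaf_exists T hT.isAcyclic univ hc0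
      (by rw [Finset.card_univ, Fintype.card_fin]; omega)
    obtain ⟨f, hf1, hf2, _, hf4⟩ := path_order T
      (fun a b c d h1 h2 h3 h4 h5 h6 => hcon ⟨a, b, c, d, h1, h2, h3, h4, h5, h6⟩) (n - 1) univ
      (by rw [Finset.card_univ, Fintype.card_fin]; omega) hc0 u (by simp) (Or.inr ⟨p, hu⟩)
    let F : Fin n → Fin n := fun v => ⟨f v, by have := hf2 v (by simp); omega⟩
    have hF : Function.Bijective F := by
      apply Function.Injective.bijective_of_finite
      intro a b hab
      exact hf1 (by simp) (by simp) (congrArg Fin.val hab)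
    exact ⟨{ toEquiv := Equiv.ofBijective F hF
             map_rel_iff' := by
               intro a b
               rw [hf4 a (by simp) b (by simp)]
               simp [pathGraph_adj, F] }⟩
  obtain ⟨c, x, y, w, hx, hy, hw, hxy, hxw, hyw⟩ := hdeg
  have hn5 : 5 ≤ n := by
    by_contra hlt
    have h4 : n = 4 := by omega
    apply hstar
    apply star_of_dom T hT.isAcyclic c
    intro v hvc
    by_contra hv
    have hvx : v ≠ x := by rintro rfl; exact hv hx
    have hvy : v ≠ y := by rintro rfl; exact hv hy
    have hvw : v ≠ w := by rintro rfl; exact hv hw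
    have hcard : ({c, v, x, y, w} : Finset (Fin n)).card = 5 := by
      rw [Finset.card_insert_of_notMem, Finset.card_insert_of_notMem, Finset.card_insert_of_notMem,
        Finset.card_insert_of_notMem, Finset.card_singleton]
      all_goals simp [hyw, hxy, hxw, hvx, hvy, hvw, hvc.symm, hx.ne, hy.ne, hw.ne]
    have := Finset.card_le_univ ({c, v, x, y, w} : Finset (Fin n))
    rw [hcard, Fintype.card_fin] at this
    omega
  obtain ⟨z, hz, h0, hz0, hz2, hpe⟩ := path_eig n hn5
  obtain ⟨a, b, d, p, q, r, hab, had, hbd, ha, hb, hd⟩ :=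
    three_leaves T hT c x y w hx hy hw hxy hxw hyw
  obtain ⟨k, rfl⟩ : ∃ k, n = k + 5 := ⟨n - 5, by omega⟩
  obtain ⟨f, hfinj, hflt, hfQ⟩ := strong_order T hT k (by simp) a b d p q r hab had hbd ha hb hd
    z hz h0 hz0 hz2
  let F : Fin (k + 5) → Fin (k + 5) := fun v => ⟨f v, hflt v⟩
  have hF : Function.Bijective F := by
    apply Function.Injective.bijective_of_finite
    intro a b hab
    exact hfinj (congrArg Fin.val hab)
  have hsum : ∀ g : ℝ → ℝ, ∑ v, g (z (f v)) = ∑ j ∈ Finset.range (k + 5), g (z j) := by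
    intro g
    rw [← Fin.sum_univ_eq_sum_range (fun j => g (z j)) (k + 5),
      ← (Equiv.ofBijective F hF).sum_comp (fun i : Fin (k + 5) => g (z i.1))]
    rfl
  obtain ⟨_, hray⟩ := lam1_spec (by omega) (distM Tᶜ)
    (fun i j => by simp [distM, SimpleGraph.dist_comm])
  have h1 := hray (fun v => z (f v))
  have h2 : ∑ i, (fun v => z (f v)) i * ∑ j, JA T i j * (fun v => z (f v)) j
      ≤ ∑ i, (fun v => z (f v)) i * ((distM Tᶜ).mulVec (fun v => z (f v))) i := by
    refine Finset.sum_le_sum fun i _ => mul_le_mul_of_nonneg_left ?_ (h0 _)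
    unfold Matrix.mulVec dotProduct
    exact Finset.sum_le_sum fun j _ =>
      mul_le_mul_of_nonneg_right (distM_ge T hT.isAcyclic hstar i j) (h0 _)
  rw [JA_quad] at h2
  have s1 := hsum (fun t => t)
  have s2 := hsum (fun t => t ^ 2)
  simp only at s1 s2 h1 h2
  rw [s2] at h1
  rw [s1, s2] at h2
  have hpos : 0 < ∑ j ∈ Finset.range (k + 5), z j ^ 2 :=
    Finset.sum_pos' (fun _ _ => sq_nonneg _) ⟨0, by simp, by positivity⟩
  have : lam1 (distM (pathGraph (k + 5))ᶜ) * ∑ j ∈ Finset.range (k + 5), z j ^ 2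
      < lam1 (distM Tᶜ) * ∑ j ∈ Finset.range (k + 5), z j ^ 2 := by
    rw [hpe]; linarith
  exact lt_of_mul_lt_mul_right this hpos.le
end
end
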